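/- Let S' = S[z_1,...,z_u] be a polynomial extension of S with a standard Z^v-graded structure extending that of S, and let I be a Z^v-graded ideal of S. The following are equivalent: (1) I is a Cartwright-Sturmfels ideal of S; (2) the extended ideal IS' is a Cartwright-Sturmfels ideal of S'; (3) IS' + (z_1,...,z_u) is a Cartwright-Sturmfels ideal of S'. -/

import Mathlib

open MvPolynomial

noncomputable section

namespace CSPaper

/-- The set of variables of the standard `ℤ^v`-graded polynomial ring `S`:
the variable `x_{i j}` of the paper (with `1 ≤ i ≤ v`, `1 ≤ j ≤ n_i`) corresponds to
`⟨i-1, j-1⟩ : MVar v n` where `n (i-1) = n_i - 1`; thus row `i` has `n i + 1 > 0`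
variables and the first variable `x_{i 1}` of row `i` corresponds to `⟨i, 0⟩`. -/
abbrev MVar (v : ℕ) (n : Fin v → ℕ) : Type := Σ i : Fin v, Fin (n i + 1)

/-- The weight function giving the standard `ℤ^v`-grading: `deg (x_{i j}) = e_i ∈ ℤ^v`. -/
def wt (v : ℕ) (n : Fin v → ℕ) : MVar v n → (Fin v → ℕ) := fun p => Pi.single p.1 1

variable {K : Type} [Field K] {v : ℕ} {n : Fin v → ℕ}

/-- An ideal of `S` is `ℤ^v`-graded (multigraded) iff it contains every multihomogeneous
component of each of its elements. -/
def IsMultigraded (I : Ideal (MvPolynomial (MVar v n) K)) : Prop :=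
  ∀ f ∈ I, ∀ a : Fin v → ℕ, weightedHomogeneousComponent (wt v n) a f ∈ I

/-- The value of the `ℤ^v`-graded Hilbert function of the ideal `I` at `a ∈ ℕ^v`:
`dim_K I_a`. -/
def hilb (I : Ideal (MvPolynomial (MVar v n) K)) (a : Fin v → ℕ) : ℕ :=
  Module.finrank K
    ((Submodule.restrictScalars K I ⊓ weightedHomogeneousSubmodule K (wt v n) a :
      Submodule K (MvPolynomial (MVar v n) K)))

/-- Two ideals have the same `ℤ^v`-graded Hilbert series. -/
def sameHS (I J : Ideal (MvPolynomial (MVar v n) K)) : Prop :=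
  ∀ a : Fin v → ℕ, hilb I a = hilb J a

/-- The `ℤ^v`-graded `K`-algebra endomorphism of `S` determined by a `v`-tuple of square
matrices: `x_{i j} ↦ ∑_k (g i)_{k j} x_{i k}`.  For invertible `g i` these are exactly the
elements of `G = GL_{n_1}(K) × ⋯ × GL_{n_v}(K)` acting on `S`. -/
def gAct (g : ∀ i : Fin v, Matrix (Fin (n i + 1)) (Fin (n i + 1)) K) :
    MvPolynomial (MVar v n) K →ₐ[K] MvPolynomial (MVar v n) K :=
  aeval fun p : MVar v n => ∑ k : Fin (n p.1 + 1), C (g p.1 k p.2) * X ⟨p.1, k⟩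

/-- A property `P` of `v`-tuples of matrices holds generically (i.e. for a general
`g ∈ GL_{n_1}(K) × ⋯ × GL_{n_v}(K)`) if there is a nonzero polynomial `h` in the matrix
entries such that `P g` holds for every invertible `g` with `h(g) ≠ 0`. -/
def Generically
    (P : (∀ i : Fin v, Matrix (Fin (n i + 1)) (Fin (n i + 1)) K) → Prop) : Prop :=
  ∃ h : MvPolynomial (Σ i : Fin v, Fin (n i + 1) × Fin (n i + 1)) K, h ≠ 0 ∧
    ∀ g : ∀ i : Fin v, Matrix (Fin (n i + 1)) (Fin (n i + 1)) K,
      (∀ i, IsUnit (g i).det) →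
      eval (fun q : Σ i : Fin v, Fin (n i + 1) × Fin (n i + 1) => g q.1 q.2.1 q.2.2) h ≠ 0 →
      P g

/-- The leading exponent (exponent of the leading monomial) of a polynomial with respect to
a term order `τ` (a `MonomialOrder`); by convention `leadExp τ 0 = 0`. -/
def leadExp (τ : MonomialOrder (MVar v n)) (f : MvPolynomial (MVar v n) K) :
    MVar v n →₀ ℕ :=
  τ.toSyn.symm (f.support.sup τ.toSyn)

/-- The initial ideal `in_τ(I)`: the monomial ideal generated by the leading monomials of the
nonzero elements of `I`. -/
def inIdeal (τ : MonomialOrder (MVar v n)) (I : Ideal (MvPolynomial (MVar v n) K)) :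
    Ideal (MvPolynomial (MVar v n) K) :=
  Ideal.span {m | ∃ f ∈ I, f ≠ 0 ∧ m = monomial (leadExp τ f) (1 : K)}

/-- `G` is a Gröbner basis of `I` with respect to the term order `τ`. -/
def IsGroebnerBasis (τ : MonomialOrder (MVar v n)) (G : Set (MvPolynomial (MVar v n) K))
    (I : Ideal (MvPolynomial (MVar v n) K)) : Prop :=
  G ⊆ (I : Set (MvPolynomial (MVar v n) K)) ∧
    Ideal.span ((fun f => monomial (leadExp τ f) (1 : K)) '' {f ∈ G | f ≠ 0}) = inIdeal τ I

/-- `J = gin_τ(I)`, the `ℤ^v`-graded generic initial ideal: for a general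
`g ∈ GL_{n_1}(K) × ⋯ × GL_{n_v}(K)` one has `in_τ(g(I)) = J`. -/
def IsGin (τ : MonomialOrder (MVar v n)) (I J : Ideal (MvPolynomial (MVar v n) K)) : Prop :=
  Generically fun g => inIdeal τ (Ideal.map (gAct g) I) = J

/-- A term order such that `x_{i j} > x_{i k}` whenever `j < k`. -/
def RespectsVarOrder (τ : MonomialOrder (MVar v n)) : Prop :=
  ∀ (i : Fin v) (j k : Fin (n i + 1)), j < k →
    τ.toSyn (Finsupp.single (⟨i, k⟩ : MVar v n) 1) <
      τ.toSyn (Finsupp.single (⟨i, j⟩ : MVar v n) 1)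

/-- An ideal is Borel fixed if it is fixed by every element of the Borel subgroup
`B = B_{n_1}(K) × ⋯ × B_{n_v}(K)` of upper triangular invertible matrices (upper triangular
with respect to the order `x_{i 1} > x_{i 2} > ⋯` of the variables in each row). -/
def BorelFixed (I : Ideal (MvPolynomial (MVar v n) K)) : Prop :=
  ∀ g : ∀ i : Fin v, Matrix (Fin (n i + 1)) (Fin (n i + 1)) K,
    (∀ i, IsUnit (g i).det) →
    (∀ (i : Fin v) (k j : Fin (n i + 1)), j < k → g i k j = 0) →
    Ideal.map (gAct g) I = I

/-- A Cartwright-Sturmfels ideal: a `ℤ^v`-graded ideal with the same `ℤ^v`-graded Hilbert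
series as some radical Borel fixed ideal. -/
def IsCS (I : Ideal (MvPolynomial (MVar v n) K)) : Prop :=
  IsMultigraded I ∧ ∃ J : Ideal (MvPolynomial (MVar v n) K),
    J.IsRadical ∧ BorelFixed J ∧ sameHS I J

/-- The exponent of the monomial `x_{1 1}^{a 1} ⋯ x_{v 1}^{a v}` of
`T = K[x_{1 1}, …, x_{v 1}] ⊆ S`. -/
def Tmono (v : ℕ) (n : Fin v → ℕ) (a : Fin v → ℕ) : MVar v n →₀ ℕ :=
  ∑ i : Fin v, Finsupp.single (⟨i, 0⟩ : MVar v n) (a i)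

/-- A `ℤ^v`-graded ideal of `S` extended from `T`, i.e. generated by monomials in the
variables `x_{1 1}, …, x_{v 1}`. -/
def ExtendedFromT (J : Ideal (MvPolynomial (MVar v n) K)) : Prop :=
  ∃ A : Set (Fin v → ℕ),
    J = Ideal.span ((fun a => monomial (Tmono v n a) (1 : K)) '' A)

/-- A Cartwright-Sturmfels* ideal: a `ℤ^v`-graded ideal with the same `ℤ^v`-graded Hilbert
series as some ideal extended from `T`. -/
def IsCSstar (J : Ideal (MvPolynomial (MVar v n) K)) : Prop :=
  IsMultigraded J ∧ ∃ C : Ideal (MvPolynomial (MVar v n) K), ExtendedFromT C ∧ sameHS J C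

/-- A monomial ideal. -/
def IsMonomialIdeal (I : Ideal (MvPolynomial (MVar v n) K)) : Prop :=
  ∃ A : Set (MVar v n →₀ ℕ), I = Ideal.span ((fun s => monomial s (1 : K)) '' A)

/-- A squarefree monomial ideal. -/
def IsSqfreeMonomialIdeal (I : Ideal (MvPolynomial (MVar v n) K)) : Prop :=
  ∃ A : Set (MVar v n →₀ ℕ), (∀ s ∈ A, ∀ x, s x ≤ 1) ∧
    I = Ideal.span ((fun s => monomial s (1 : K)) '' A)

/-- `J` is the Alexander dual of the squarefree monomial ideal `I`: `J` is generated by the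
products `∏_{x ∈ P} x` as `P` ranges over the minimal primes of `I`. -/
def IsAlexanderDual (I J : Ideal (MvPolynomial (MVar v n) K)) : Prop :=
  J = Ideal.span {m | ∃ F : Finset (MVar v n),
    Ideal.span ((fun x => (X x : MvPolynomial (MVar v n) K)) '' ↑F) ∈ I.minimalPrimes ∧
    m = ∏ x ∈ F, X x}

/-- The sequence `x_{i j} - λ_{i j} x_{i 1}`, `1 ≤ i ≤ v`, `2 ≤ j ≤ n_i`, as a list. -/
def LamList (lam : MVar v n → K) : List (MvPolynomial (MVar v n) K) :=
  (List.finRange v).flatMap fun i =>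
    ((List.finRange (n i + 1)).drop 1).map fun j =>
      X (⟨i, j⟩ : MVar v n) - C (lam ⟨i, j⟩) * X (⟨i, 0⟩ : MVar v n)

/-- A property of the scalars `λ = (λ_{i j})` holds for general `λ ∈ K^N` if there is a
nonzero polynomial `h` in the `λ_{i j}` such that the property holds whenever `h(λ) ≠ 0`. -/
def GenericallyLam {v : ℕ} {n : Fin v → ℕ} (K : Type) [Field K]
    (P : (MVar v n → K) → Prop) : Prop :=
  ∃ h : MvPolynomial (MVar v n) K, h ≠ 0 ∧
    ∀ lam : MVar v n → K, eval lam h ≠ 0 → P lam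

variable {K : Type} [Field K] {v : ℕ} {n : Fin v → ℕ}

/-- A graded free resolution of an ideal `I` of a polynomial ring graded by an additive
monoid `M` via a weight function `w` on the variables:
`⋯ → F_2 → F_1 → F_0 → I → 0`, where `F_p` is the free module with (finite) basis `ι p`,
the basis element `i : ι p` having degree `deg p i ∈ M`, all maps are graded of degree `0`,
and the complex is exact. -/
structure GradedFreeResolution (σ : Type) (K : Type) [Field K] (M : Type) [AddCommMonoid M]
    (w : σ → M) (I : Ideal (MvPolynomial σ K)) where
  ι : ℕ → Type
  finite : ∀ p, Finite (ι p)
  deg : ∀ p, ι p → M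
  aug : (ι 0 →₀ MvPolynomial σ K) →ₗ[MvPolynomial σ K] MvPolynomial σ K
  d : ∀ p, (ι (p + 1) →₀ MvPolynomial σ K) →ₗ[MvPolynomial σ K] (ι p →₀ MvPolynomial σ K)
  aug_graded : ∀ i : ι 0, (aug (Finsupp.single i 1)).IsWeightedHomogeneous w (deg 0 i)
  d_graded : ∀ (p : ℕ) (i : ι (p + 1)) (j : ι p),
    (d p (Finsupp.single i 1)) j = 0 ∨
      ∃ b, ((d p (Finsupp.single i 1)) j).IsWeightedHomogeneous w b ∧
        b + deg p j = deg (p + 1) i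
  range_aug : LinearMap.range aug = (I : Submodule (MvPolynomial σ K) (MvPolynomial σ K))
  exact_zero : LinearMap.ker aug = LinearMap.range (d 0)
  exact : ∀ p, LinearMap.ker (d p) = LinearMap.range (d (p + 1))

/-- A graded free resolution is minimal if all entries of the matrices of the differentials
between free modules lie in the irrelevant maximal ideal, i.e. have zero constant term. -/
def GradedFreeResolution.Minimal {σ M : Type} [AddCommMonoid M] {w : σ → M}
    {I : Ideal (MvPolynomial σ K)} (F : GradedFreeResolution σ K M w I) : Prop :=
  ∀ (p : ℕ) (i : F.ι (p + 1)) (j : F.ι p),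
    MvPolynomial.constantCoeff ((F.d p (Finsupp.single i 1)) j) = 0

/-- The graded Betti number `β_{p,a}` read off from a (minimal) graded free resolution:
the number of basis elements of `F_p` of degree `a`. -/
def GradedFreeResolution.betti {σ M : Type} [AddCommMonoid M] {w : σ → M}
    {I : Ideal (MvPolynomial σ K)} (F : GradedFreeResolution σ K M w I) (p : ℕ) (a : M) :
    ℕ :=
  Nat.card {i : F.ι p // F.deg p i = a}

/-- The set of `t × t` minors of the matrix `A`. -/
def minorsSet {R : Type} [CommRing R] (t : ℕ) {m N : ℕ} (A : Matrix (Fin m) (Fin N) R) :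
    Set R :=
  {d | ∃ (r : Fin t → Fin m) (c : Fin t → Fin N),
    Function.Injective r ∧ Function.Injective c ∧ d = (A.submatrix r c).det}

/-- `I_t(A)`, the ideal generated by the `t × t` minors of `A`. -/
def minorsIdeal {R : Type} [CommRing R] (t : ℕ) {m N : ℕ}
    (A : Matrix (Fin m) (Fin N) R) : Ideal R :=
  Ideal.span (minorsSet t A)

/-- `A` is column-graded: `N ≤ v` and each entry of the `j`-th column is either `0` or
multihomogeneous of degree `e_j ∈ ℤ^v`. -/
def ColumnGraded {m N : ℕ} (A : Matrix (Fin m) (Fin N) (MvPolynomial (MVar v n) K)) :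
    Prop :=
  ∃ h : N ≤ v, ∀ i j, A i j = 0 ∨
    (A i j).IsWeightedHomogeneous (wt v n) (Pi.single (Fin.castLE h j) 1)

/-- `A` is row-graded: `m ≤ v` and each entry of the `i`-th row is either `0` or
multihomogeneous of degree `e_i ∈ ℤ^v`. -/
def RowGraded {m N : ℕ} (A : Matrix (Fin m) (Fin N) (MvPolynomial (MVar v n) K)) : Prop :=
  ∃ h : m ≤ v, ∀ i j, A i j = 0 ∨
    (A i j).IsWeightedHomogeneous (wt v n) (Pi.single (Fin.castLE h i) 1)

/-- The exponent of the polarization of the monomial `x_{1 1}^{a 1} ⋯ x_{v 1}^{a v}` of `T`: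
the squarefree monomial `∏_i x_{i 1} x_{i 2} ⋯ x_{i (a i)}`. -/
def polExp (v : ℕ) (n : Fin v → ℕ) (a : Fin v → ℕ) : MVar v n →₀ ℕ :=
  ∑ i : Fin v, ∑ j ∈ Finset.univ.filter (fun j : Fin (n i + 1) => (j : ℕ) < a i),
    Finsupp.single (⟨i, j⟩ : MVar v n) 1

/-- `P = pol(C)`, the polarization of an ideal `C` extended from `T`
(the exponents of the generators of `C` must fit inside `S`). -/
def IsPolarizationOfT (C P : Ideal (MvPolynomial (MVar v n) K)) : Prop :=
  ∃ A : Set (Fin v → ℕ), (∀ a ∈ A, ∀ i, a i ≤ n i + 1) ∧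
    C = Ideal.span ((fun a => monomial (Tmono v n a) (1 : K)) '' A) ∧
    P = Ideal.span ((fun a => monomial (polExp v n a) (1 : K)) '' A)

/-- `ψ` is an identification of the quotient of `S` by the `ℤ^v`-graded ideal `Q` with a
standard `ℤ^v`-graded polynomial ring, compatible with the gradings. -/
def IsGradedStructureIso {n₂ : Fin v → ℕ} (Q : Ideal (MvPolynomial (MVar v n) K))
    (ψ : (MvPolynomial (MVar v n) K ⧸ Q) ≃ₐ[K] MvPolynomial (MVar v n₂) K) : Prop :=
  ∀ (f : MvPolynomial (MVar v n) K) (a : Fin v → ℕ),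
    f.IsWeightedHomogeneous (wt v n) a →
      (ψ (Ideal.Quotient.mk Q f)).IsWeightedHomogeneous (wt v n₂) a

end CSPaper

open CSPaper

namespace CSPaper

section LeadingExponents

variable {σ K Γ : Type} [Field K] [AddCommMonoid Γ] [LinearOrder Γ]

/-- `m` is the leading exponent of `f` for the order on exponents induced by `θ`. -/
def IsLead (θ : (σ →₀ ℕ) →+ Γ) (f : MvPolynomial σ K) (m : σ →₀ ℕ) : Prop :=
  m ∈ f.support ∧ ∀ u ∈ f.support, θ u ≤ θ m

/-- The exponents of the standard monomials of `I`. -/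
def stdExps (θ : (σ →₀ ℕ) →+ Γ) (I : Ideal (MvPolynomial σ K)) : Set (σ →₀ ℕ) :=
  {m | ¬ ∃ f ∈ I, IsLead θ f m}

theorem exists_isLead (θ : (σ →₀ ℕ) →+ Γ) {f : MvPolynomial σ K} (hf : f ≠ 0) :
    ∃ m, IsLead θ f m :=
  f.support.exists_max_image θ (support_nonempty.mpr hf)

theorem isLowerSet_stdExps [IsOrderedAddMonoid Γ] (θ : (σ →₀ ℕ) →+ Γ)
    (I : Ideal (MvPolynomial σ K)) : IsLowerSet (stdExps θ I) := by
  rintro m m' hle hm ⟨f, hf, hm', hmax⟩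
  refine hm ⟨monomial (m - m') 1 * f, I.mul_mem_left _ hf, ?_, ?_⟩
  · rw [mem_support_iff, coeff_monomial_mul', if_pos tsub_le_self, one_mul,
      tsub_tsub_cancel_of_le hle]
    exact mem_support_iff.mp hm'
  · intro u hu
    rw [mem_support_iff, coeff_monomial_mul'] at hu
    split_ifs at hu with h
    · have h1 : θ (u - (m - m')) ≤ θ m' := hmax _ (mem_support_iff.mpr (by simpa using hu))
      rw [← tsub_add_cancel_of_le h, ← tsub_add_cancel_of_le hle, map_add, map_add, add_comm]
      simpa using add_le_add_right h1 _
    · exact absurd rfl hu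

theorem finrank_eq_ncard_isLead (θ : (σ →₀ ℕ) →+ Γ) (hθ : Function.Injective θ)
    (V : Submodule K (MvPolynomial σ K)) (hfin : {m | ∃ f ∈ V, IsLead θ f m}.Finite) :
    Module.finrank K V = {m | ∃ f ∈ V, IsLead θ f m}.ncard := by
  set Λ := {m | ∃ f ∈ V, IsLead θ f m}
  have : Fintype Λ := hfin.fintype
  let φ : V →ₗ[K] (Λ → K) := LinearMap.pi fun m => (lcoeff K m.1).comp V.subtype
  have hφ : Function.Injective φ := by
    rw [← LinearMap.ker_eq_bot, LinearMap.ker_eq_bot']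
    intro f hf
    by_contra hne
    obtain ⟨m, hm⟩ := exists_isLead θ (f := f.1) (by simpa using hne)
    have := congrFun hf ⟨m, f.1, f.2, hm⟩
    exact mem_support_iff.mp hm.1 (by simpa [φ] using this)
  have : FiniteDimensional K V := FiniteDimensional.of_injective φ hφ
  choose F hFV hF using fun m : Λ => m.2
  have hli : LinearIndependent K (fun m => (⟨F m, hFV m⟩ : V)) := by
    rw [Fintype.linearIndependent_iff]
    intro g hg
    by_contra! hne
    obtain ⟨i, hi⟩ := hne
    classical
    obtain ⟨m, hm, hmax⟩ := (Finset.univ.filter fun m => g m ≠ 0).exists_max_image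
      (fun m : Λ => θ m) ⟨i, by simpa using hi⟩
    have h0 : coeff m.1 (∑ k, g k • F k) = 0 := by
      have := congrArg (fun x : V => coeff m.1 (x : MvPolynomial σ K)) hg
      simpa using this
    rw [coeff_sum, Finset.sum_eq_single m] at h0
    · rw [coeff_smul, smul_eq_mul, mul_eq_zero] at h0
      exact h0.elim (by simpa using hm) (mem_support_iff.mp (hF m).1)
    · intro k _ hk
      by_cases hgk : g k = 0
      · simp [hgk]
      · rw [coeff_smul, smul_eq_mul, mul_eq_zero]
        refine Or.inr (by_contra fun hc => hk ?_)
        have h1 := (hF k).2 m.1 (mem_support_iff.mpr hc)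
        have h2 := hmax k (by simpa using hgk)
        exact Subtype.ext (hθ (le_antisymm h2 h1))
    · simp
  rw [Set.ncard_eq_toFinset_card' Λ, Set.toFinset_card]
  refine le_antisymm ?_ hli.fintype_card_le_finrank
  simpa using LinearMap.finrank_le_finrank_of_injective hφ

end LeadingExponents

section Degrees

variable {K : Type} [Field K] {v : ℕ} {n : Fin v → ℕ}

/-- The multidegree of a monomial with given exponents. -/
def mdeg (v : ℕ) (n : Fin v → ℕ) : (MVar v n →₀ ℕ) →+ (Fin v →₀ ℕ) :=
  Finsupp.mapDomain.addMonoidHom Sigma.fst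

@[simp]
theorem mdeg_single (q : MVar v n) (k : ℕ) :
    mdeg v n (Finsupp.single q k) = Finsupp.single q.1 k :=
  Finsupp.mapDomain_single

theorem weight_wt (m : MVar v n →₀ ℕ) : Finsupp.weight (wt v n) m = ⇑(mdeg v n m) := by
  induction m using Finsupp.induction_linear with
  | zero => simp
  | add f g hf hg => simp [hf, hg]
  | single q k =>
    rw [Finsupp.weight_single, mdeg_single, wt, ← Finsupp.single_eq_pi_single]
    ext i
    simp [Finsupp.single_apply]

theorem weight_wt_eq_iff (m : MVar v n →₀ ℕ) (d : Fin v →₀ ℕ) :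
    Finsupp.weight (wt v n) m = ⇑d ↔ mdeg v n m = d := by
  rw [weight_wt, DFunLike.coe_fn_eq]

theorem le_mdeg (m : MVar v n →₀ ℕ) (q : MVar v n) : m q ≤ mdeg v n m q.1 := by
  have h : Finsupp.single q (m q) ≤ m := by simp
  have h2 : mdeg v n (Finsupp.single q (m q)) ≤ mdeg v n m := by
    obtain ⟨r, hr⟩ := exists_add_of_le h
    conv_rhs => rw [hr, map_add]
    exact le_self_add
  simpa using h2 q.1

theorem finite_mdeg_eq (d : Fin v →₀ ℕ) : {m : MVar v n →₀ ℕ | mdeg v n m = d}.Finite := by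
  refine (Set.finite_Iic (Finsupp.equivFunOnFinite.symm fun q : MVar v n => d q.1)).subset ?_
  rintro m rfl q
  simpa using le_mdeg m q

theorem hilb_eq_ncard {Γ : Type} [AddCommMonoid Γ] [LinearOrder Γ]
    (θ : (MVar v n →₀ ℕ) →+ Γ) (hθ : Function.Injective θ)
    {I : Ideal (MvPolynomial (MVar v n) K)} (hI : IsMultigraded I) (d : Fin v →₀ ℕ) :
    hilb I ⇑d = {m | m ∈ (stdExps θ I)ᶜ ∧ mdeg v n m = d}.ncard := by
  have key : {m | m ∈ (stdExps θ I)ᶜ ∧ mdeg v n m = d} =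
      {m | ∃ f ∈ (Submodule.restrictScalars K I ⊓
        weightedHomogeneousSubmodule K (wt v n) ⇑d :
          Submodule K (MvPolynomial (MVar v n) K)), IsLead θ f m} := by
    ext m
    constructor
    · rintro ⟨hm, rfl⟩
      obtain ⟨f, hf, hm, hmax⟩ := not_not.mp hm
      refine ⟨weightedHomogeneousComponent (wt v n) ⇑(mdeg v n m) f,
        ⟨hI f hf _, weightedHomogeneousComponent_mem _ _ _⟩, ?_, fun u hu => hmax u ?_⟩
      · classical
        rw [mem_support_iff, coeff_weightedHomogeneousComponent, if_pos (weight_wt m)]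
        exact mem_support_iff.mp hm
      · classical
        rw [mem_support_iff, coeff_weightedHomogeneousComponent] at hu
        exact mem_support_iff.mpr fun h => hu (by simp [h])
    · rintro ⟨f, ⟨hf, hw⟩, hm⟩
      refine ⟨fun h => h ⟨f, hf, hm⟩, ?_⟩
      rw [← weight_wt_eq_iff]
      exact hw (mem_support_iff.mp hm.1)
  rw [hilb, key]
  apply finrank_eq_ncard_isLead θ hθ
  rw [← key]
  exact (finite_mdeg_eq d).subset fun m hm => hm.2

/-- The generating series of the multidegrees of a set of exponents. -/
def hser (M : Set (MVar v n →₀ ℕ)) : MvPowerSeries (Fin v) ℤ :=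
  fun d => ({m | m ∈ M ∧ mdeg v n m = d}.ncard : ℤ)

theorem coeff_hser (M : Set (MVar v n →₀ ℕ)) (d : Fin v →₀ ℕ) :
    MvPowerSeries.coeff d (hser M) = ({m | m ∈ M ∧ mdeg v n m = d}.ncard : ℤ) := rfl

theorem finite_fiber (M : Set (MVar v n →₀ ℕ)) (d : Fin v →₀ ℕ) :
    {m | m ∈ M ∧ mdeg v n m = d}.Finite :=
  (finite_mdeg_eq d).subset fun _ hm => hm.2

theorem hser_union {M N : Set (MVar v n →₀ ℕ)} (h : Disjoint M N) :
    hser (M ∪ N) = hser M + hser N := by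
  ext d
  rw [map_add, coeff_hser, coeff_hser, coeff_hser, ← Nat.cast_add,
    ← Set.ncard_union_eq ?_ (finite_fiber M d) (finite_fiber N d)]
  · congr 2
    ext m
    simp only [Set.mem_union, Set.mem_ofPred_eq]
    tauto
  · exact h.mono (fun _ hm => hm.1) (fun _ hm => hm.1)

@[simp]
theorem hser_empty : hser (∅ : Set (MVar v n →₀ ℕ)) = 0 := by
  ext d
  simp [coeff_hser]

theorem hser_add_compl (M : Set (MVar v n →₀ ℕ)) :
    hser M + hser Mᶜ = hser (Set.univ : Set (MVar v n →₀ ℕ)) := by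
  rw [← hser_union disjoint_compl_right, Set.union_compl_self]

theorem hser_biUnion {κ : Type} (s : Finset κ) (M : κ → Set (MVar v n →₀ ℕ))
    (h : Pairwise fun i j => Disjoint (M i) (M j)) :
    hser (⋃ k ∈ s, M k) = ∑ k ∈ s, hser (M k) := by
  classical
  induction s using Finset.induction_on with
  | empty => simp
  | insert a s ha ih =>
    rw [Finset.set_biUnion_insert, hser_union, ih, Finset.sum_insert ha]
    simp only [Set.disjoint_iUnion_right]
    exact fun i hi => h fun e => ha (e ▸ hi)

theorem hser_image {n' : Fin v → ℕ} (M : Set (MVar v n →₀ ℕ))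
    (e : (MVar v n →₀ ℕ) → (MVar v n' →₀ ℕ)) (he : Function.Injective e)
    (hd : ∀ m, mdeg v n' (e m) = mdeg v n m) : hser (e '' M) = hser M := by
  ext d
  rw [coeff_hser, coeff_hser, ← Set.ncard_image_of_injective _ he]
  congr 2
  ext m
  constructor
  · rintro ⟨⟨u, hu, rfl⟩, rfl⟩
    exact ⟨u, ⟨hu, (hd u).symm⟩, rfl⟩
  · rintro ⟨u, ⟨hu, rfl⟩, rfl⟩
    exact ⟨⟨u, hu, rfl⟩, hd u⟩

theorem hser_shift (M : Set (MVar v n →₀ ℕ)) (u : MVar v n →₀ ℕ) :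
    hser ((fun m => u + m) '' M) = MvPowerSeries.monomial (mdeg v n u) (1 : ℤ) * hser M := by
  classical
  ext d
  rw [MvPowerSeries.coeff_monomial_mul, coeff_hser]
  split_ifs with h
  · rw [coeff_hser, one_mul, 
      ← Set.ncard_image_of_injective {m | m ∈ M ∧ mdeg v n m = d - mdeg v n u}
        (add_right_injective u)]
    congr 2
    ext m
    constructor
    · rintro ⟨⟨w, hw, rfl⟩, rfl⟩
      exact ⟨w, ⟨hw, by simp⟩, rfl⟩
    · rintro ⟨w, ⟨hw, hwd⟩, rfl⟩
      refine ⟨⟨w, hw, rfl⟩, ?_⟩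
      change mdeg v n (u + w) = d
      rw [map_add, hwd, add_tsub_cancel_of_le h]
  · rw [Nat.cast_eq_zero, Set.ncard_eq_zero (finite_fiber _ d), Set.eq_empty_iff_forall_notMem]
    rintro m ⟨⟨w, hw, rfl⟩, rfl⟩
    exact h (by simp)

theorem sameHS_iff_hser {Γ Γ' : Type} [AddCommMonoid Γ] [LinearOrder Γ]
    [AddCommMonoid Γ'] [LinearOrder Γ']
    {θ : (MVar v n →₀ ℕ) →+ Γ} (hθ : Function.Injective θ)
    {θ' : (MVar v n →₀ ℕ) →+ Γ'} (hθ' : Function.Injective θ')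
    {I J : Ideal (MvPolynomial (MVar v n) K)} (hI : IsMultigraded I) (hJ : IsMultigraded J) :
    sameHS I J ↔ hser (stdExps θ I) = hser (stdExps θ' J) := by
  have h1 := hser_add_compl (stdExps θ I)
  rw [← hser_add_compl (stdExps θ' J)] at h1
  have h2 : sameHS I J ↔ hser (stdExps θ I)ᶜ = hser (stdExps θ' J)ᶜ := by
    constructor
    · intro h
      ext d
      rw [coeff_hser, coeff_hser, ← hilb_eq_ncard θ hθ hI, ← hilb_eq_ncard θ' hθ' hJ, h]
    · intro h a
      obtain ⟨d, rfl⟩ : ∃ d : Fin v →₀ ℕ, a = ⇑d := ⟨Finsupp.equivFunOnFinite.symm a, rfl⟩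
      have := congrArg (MvPowerSeries.coeff d) h
      rw [coeff_hser, coeff_hser, ← hilb_eq_ncard θ hθ hI, ← hilb_eq_ncard θ' hθ' hJ] at this
      exact_mod_cast this
  rw [h2]
  constructor
  · intro h
    rw [h] at h1
    exact add_right_cancel h1
  · intro h
    rw [h] at h1
    exact add_left_cancel h1

end Degrees

section Decompositions

variable {v : ℕ} {n : Fin v → ℕ}

/-- The product of the `1 - y_q` over all variables, i.e. the inverse of the Hilbert series of
the polynomial ring. -/
def denom (v : ℕ) (n : Fin v → ℕ) : MvPowerSeries (Fin v) ℤ :=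
  ∏ q : MVar v n, (1 - MvPowerSeries.X q.1)

theorem denom_ne_zero : denom v n ≠ 0 := by
  intro h
  have := congrArg MvPowerSeries.constantCoeff h
  simp [denom] at this

theorem hser_split (T : Set (MVar v n →₀ ℕ)) (q : MVar v n) :
    hser T = hser (T ∩ {m | m q = 0}) +
      MvPowerSeries.X q.1 * hser {m | Finsupp.single q 1 + m ∈ T} := by
  have h := hser_shift {m | Finsupp.single q 1 + m ∈ T} (Finsupp.single q 1)
  rw [mdeg_single] at h
  rw [MvPowerSeries.X, ← h, ← hser_union]
  · congr 1
    ext m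
    constructor
    · intro hm
      by_cases h0 : m q = 0
      · exact Or.inl ⟨hm, h0⟩
      · have hle : Finsupp.single q 1 ≤ m := by
          simpa using Nat.one_le_iff_ne_zero.mpr h0
        refine Or.inr ⟨m - Finsupp.single q 1, ?_, add_tsub_cancel_of_le hle⟩
        change Finsupp.single q 1 + (m - Finsupp.single q 1) ∈ T
        rwa [add_tsub_cancel_of_le hle]
    · rintro (⟨hm, -⟩ | ⟨w, hw, rfl⟩)
      · exact hm
      · exact hw
  · rw [Set.disjoint_left]
    rintro m ⟨-, h0⟩ ⟨w, -, rfl⟩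
    simp at h0

theorem hser_inter_of_invariant {T : Set (MVar v n →₀ ℕ)} {q : MVar v n}
    (hT : ∀ m, Finsupp.single q 1 + m ∈ T ↔ m ∈ T) :
    hser (T ∩ {m | m q = 0}) = (1 - MvPowerSeries.X q.1) * hser T := by
  have h := hser_split T q
  rw [show {m | Finsupp.single q 1 + m ∈ T} = T from Set.ext hT] at h
  linear_combination -h

theorem hser_inter_forall_of_invariant {T : Set (MVar v n →₀ ℕ)} (A : Finset (MVar v n))
    (hT : ∀ q ∈ A, ∀ m, Finsupp.single q 1 + m ∈ T ↔ m ∈ T) :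
    hser (T ∩ {m | ∀ q ∈ A, m q = 0}) = (∏ q ∈ A, (1 - MvPowerSeries.X q.1)) * hser T := by
  classical
  induction A using Finset.induction_on with
  | empty => simp
  | insert a A ha ih =>
    rw [Finset.prod_insert ha, mul_assoc,
      ← ih fun q hq => hT q (Finset.mem_insert_of_mem hq), ← hser_inter_of_invariant]
    · congr 1
      ext m
      simp only [Finset.forall_mem_insert, Set.mem_inter_iff, Set.mem_ofPred_eq]
      tauto
    · intro m
      simp only [Set.mem_inter_iff, Set.mem_ofPred_eq, hT a (Finset.mem_insert_self a A)]
      refine and_congr_right fun _ => forall₂_congr fun q hq => ?_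
      have : a ≠ q := fun h => ha (h ▸ hq)
      simp [Finsupp.single_eq_of_ne' this]

theorem hser_univ_mul_denom : hser (Set.univ : Set (MVar v n →₀ ℕ)) * denom v n = 1 := by
  classical
  have h := hser_inter_forall_of_invariant (T := (Set.univ : Set (MVar v n →₀ ℕ)))
    Finset.univ (by simp)
  rw [mul_comm, denom, ← h]
  have : (Set.univ ∩ {m : MVar v n →₀ ℕ | ∀ q ∈ Finset.univ, m q = 0}) = {0} := by
    ext m
    simp [Finsupp.ext_iff]
  rw [this]
  ext d
  rw [coeff_hser, MvPowerSeries.coeff_one]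
  split_ifs with hd
  · rw [show {m : MVar v n →₀ ℕ | m ∈ ({0} : Set _) ∧ mdeg v n m = d} = {0} by
      ext m
      simp only [Set.mem_singleton_iff, Set.mem_ofPred_eq, and_iff_left_iff_imp]
      rintro rfl
      simp [hd]]
    simp
  · rw [Nat.cast_eq_zero, Set.ncard_eq_zero (finite_fiber _ d), Set.eq_empty_iff_forall_notMem]
    rintro m ⟨hm, rfl⟩
    rw [Set.mem_singleton_iff] at hm
    exact hd (by simp [hm])

theorem coe_one_sub_X (i : Fin v) :
    ((1 - X i : MvPolynomial (Fin v) ℤ) : MvPowerSeries (Fin v) ℤ) = 1 - MvPowerSeries.X i := by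
  rw [← coeToMvPowerSeries.ringHom_apply, map_sub, map_one, coeToMvPowerSeries.ringHom_apply,
    coe_X]

/-- The numerator of the Hilbert series of a translated coordinate subspace of exponents. -/
def decTerm (a : Fin v →₀ ℕ) (B : Finset (MVar v n)) : MvPolynomial (Fin v) ℤ :=
  monomial a 1 * ∏ q ∈ B, (1 - X q.1)

/-- `p` is the sum of the numerators of finitely many translated coordinate subspaces
`{m | m = a + u, u q = 0 for q ∈ B}`, with `B ⊆ A`. -/
def HasDec (A : Finset (MVar v n)) (p : MvPolynomial (Fin v) ℤ) : Prop :=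
  ∃ (κ : Type) (_ : Fintype κ) (a : κ → Fin v →₀ ℕ) (B : κ → Finset (MVar v n)),
    (∀ k, B k ⊆ A) ∧ p = ∑ k, decTerm (a k) (B k)

theorem HasDec.zero (A : Finset (MVar v n)) : HasDec A 0 :=
  ⟨Empty, inferInstance, fun _ => 0, fun _ => ∅, by simp, by simp⟩

theorem HasDec.one (A : Finset (MVar v n)) : HasDec A 1 :=
  ⟨Unit, inferInstance, fun _ => 0, fun _ => ∅, by simp, by simp [decTerm]⟩

theorem HasDec.mono {A A' : Finset (MVar v n)} (h : A ⊆ A') {p : MvPolynomial (Fin v) ℤ}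
    (hp : HasDec A p) : HasDec A' p := by
  obtain ⟨κ, _, a, B, hB, rfl⟩ := hp
  exact ⟨κ, inferInstance, a, B, fun k => (hB k).trans h, rfl⟩

theorem HasDec.add {A : Finset (MVar v n)} {p p' : MvPolynomial (Fin v) ℤ}
    (hp : HasDec A p) (hp' : HasDec A p') : HasDec A (p + p') := by
  obtain ⟨κ, _, a, B, hB, rfl⟩ := hp
  obtain ⟨κ', _, a', B', hB', rfl⟩ := hp'
  refine ⟨κ ⊕ κ', inferInstance, Sum.elim a a', Sum.elim B B', ?_, ?_⟩
  · rintro (k | k)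
    exacts [hB k, hB' k]
  · simp [Fintype.sum_sum_type]

theorem HasDec.X_mul {A : Finset (MVar v n)} {p : MvPolynomial (Fin v) ℤ}
    (hp : HasDec A p) (i : Fin v) : HasDec A (X i * p) := by
  obtain ⟨κ, _, a, B, hB, rfl⟩ := hp
  refine ⟨κ, inferInstance, fun k => Finsupp.single i 1 + a k, B, hB, ?_⟩
  rw [Finset.mul_sum]
  refine Finset.sum_congr rfl fun k _ => ?_
  rw [decTerm, decTerm, ← mul_assoc, X, monomial_mul, one_mul]

theorem HasDec.one_sub_X_mul [DecidableEq (MVar v n)] {A : Finset (MVar v n)}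
    {p : MvPolynomial (Fin v) ℤ} (hp : HasDec A p) {q : MVar v n} (hq : q ∉ A) :
    HasDec (insert q A) ((1 - X q.1) * p) := by
  obtain ⟨κ, _, a, B, hB, rfl⟩ := hp
  refine ⟨κ, inferInstance, a, fun k => insert q (B k),
    fun k => Finset.insert_subset_insert q (hB k), ?_⟩
  rw [Finset.mul_sum]
  refine Finset.sum_congr rfl fun k _ => ?_
  rw [decTerm, decTerm, Finset.prod_insert fun h => hq (hB k h)]
  ring

theorem wellFoundedLT_lowerSet {α : Type} [PartialOrder α] [WellQuasiOrderedLE α] :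
    WellFoundedLT (LowerSet α) := by
  refine ⟨RelEmbedding.wellFounded_iff_isEmpty.mpr ⟨fun f => ?_⟩⟩
  have hf : ∀ k, ∃ x, x ∈ f k ∧ x ∉ f (k + 1) := fun k =>
    Set.exists_of_ssubset (LowerSet.coe_ssubset_coe.mpr (f.map_rel_iff.mpr (Nat.lt_succ_self k)))
  choose x hx hx' using hf
  obtain ⟨i, j, hij, hle⟩ := wellQuasiOrdered_le (α := α) x
  have hanti : Antitone fun k => f k :=
    antitone_nat_of_succ_le fun k => (f.map_rel_iff.mpr (Nat.lt_succ_self k)).le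
  exact hx' i ((f (i + 1)).lower hle (hanti (Nat.succ_le_of_lt hij) (hx j)))

theorem exists_hasDec (A : Finset (MVar v n)) (T : LowerSet (MVar v n →₀ ℕ))
    (hT : ∀ q ∉ A, ∀ m ∈ T, Finsupp.single q 1 + m ∈ T) :
    ∃ p, HasDec A p ∧ hser (T : Set (MVar v n →₀ ℕ)) * denom v n = p := by
  classical
  induction A using Finset.induction_on generalizing T with
  | empty =>
    by_cases h0 : (0 : MVar v n →₀ ℕ) ∈ T
    · have : (T : Set (MVar v n →₀ ℕ)) = Set.univ := by
        rw [Set.eq_univ_iff_forall]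
        intro m
        have : ∀ m : MVar v n →₀ ℕ, m ∈ T := by
          intro m
          induction m using Finsupp.induction_linear with
          | zero => exact h0
          | add f g hf hg =>
            clear hf
            induction f using Finsupp.induction_linear generalizing g with
            | zero => simpa
            | add f₁ f₂ h₁ h₂ =>
              rw [add_assoc]
              exact h₁ _ (h₂ _ hg)
            | single q k =>
              induction k with
              | zero => simpa
              | succ k ih =>
                rw [add_comm k 1, Finsupp.single_add, add_assoc]
                exact hT q (by simp) _ ih
          | single q k =>
            induction k with
            | zero => simpa
            | succ k ih =>
              rw [add_comm k 1, Finsupp.single_add]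
              exact hT q (by simp) _ ih
        exact this m
      exact ⟨1, HasDec.one _, by rw [this, hser_univ_mul_denom]; simp⟩
    · have : (T : Set (MVar v n →₀ ℕ)) = ∅ := by
        rw [Set.eq_empty_iff_forall_notMem]
        exact fun m hm => h0 (T.lower (by simp) hm)
      exact ⟨0, HasDec.zero _, by simp [this]⟩
  | insert q A hq ih =>
    have := wellFoundedLT_lowerSet (α := MVar v n →₀ ℕ)
    induction T using WellFoundedLT.induction with
    | ind T IH =>
      let C : LowerSet (MVar v n →₀ ℕ) :=
        ⟨{m | Finsupp.single q 1 + m ∈ T}, fun m m' hle hm => T.lower (by gcongr) hm⟩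
      have hCT : C ≤ T := fun m hm => T.lower le_add_self hm
      rcases hCT.eq_or_lt with hC | hC
      · obtain ⟨p, hp, h⟩ := ih T fun r hr m hm => by
          by_cases hrq : r = q
          · subst hrq
            rw [← hC] at hm
            exact hm
          · exact hT r (by simp [hrq, hr]) m hm
        exact ⟨p, hp.mono (Finset.subset_insert q A), h⟩
      · obtain ⟨p, hp, h⟩ := IH C hC fun r hr m hm => by
          change Finsupp.single q 1 + (Finsupp.single r 1 + m) ∈ T
          rw [add_left_comm]
          exact hT r hr _ hm
        let Z : LowerSet (MVar v n →₀ ℕ) :=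
          ⟨{m | m.erase q ∈ T}, fun m m' hle hm => T.lower (by
            intro r
            by_cases hr : r = q
            · simp [hr]
            · simpa [Finsupp.erase_ne hr] using hle r) hm⟩
        have hZq : ∀ m, Finsupp.single q 1 + m ∈ (Z : Set (MVar v n →₀ ℕ)) ↔
            m ∈ (Z : Set (MVar v n →₀ ℕ)) := fun m => by
          change Finsupp.erase q (Finsupp.single q 1 + m) ∈ T ↔ m.erase q ∈ T
          simp [Finsupp.erase_add]
        obtain ⟨p', hp', h'⟩ := ih Z fun r hr m hm => by
          by_cases hrq : r = q
          · subst hrq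
            exact (hZq m).mpr hm
          · change Finsupp.erase q (Finsupp.single r 1 + m) ∈ T
            rw [Finsupp.erase_add, Finsupp.erase_single_ne (Ne.symm hrq)]
            exact hT r (by simp [hrq, hr]) _ hm
        refine ⟨(1 - X q.1) * p' + X q.1 * p,
          (hp'.one_sub_X_mul hq).add (hp.X_mul _), ?_⟩
        have hTZ : (T : Set (MVar v n →₀ ℕ)) ∩ {m | m q = 0} =
            (Z : Set (MVar v n →₀ ℕ)) ∩ {m | m q = 0} := by
          ext m
          refine and_congr_left fun (h0 : m q = 0) => ?_
          change m ∈ T ↔ m.erase q ∈ T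
          rw [Finsupp.erase_of_notMem_support (by simpa using h0)]
        rw [hser_split _ q, hTZ, hser_inter_of_invariant hZq]
        push_cast
        rw [coe_one_sub_X, ← h, ← h']
        change (_ + _ * hser (C : Set (MVar v n →₀ ℕ))) * _ = _
        ring

end Decompositions

section Types

variable {v : ℕ} {n : Fin v → ℕ}

/-- The number of elements of `B` in each row. -/
def rowCount (B : Finset (MVar v n)) : Fin v →₀ ℕ := ∑ q ∈ B, Finsupp.single q.1 1

theorem rowCount_apply (B : Finset (MVar v n)) (i : Fin v) :
    rowCount B i = (B.filter fun q => q.1 = i).card := by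
  rw [rowCount, Finsupp.finsetSum_apply, Finset.card_filter]
  exact Finset.sum_congr rfl fun q _ => by simp [Finsupp.single_apply]

theorem exists_aeval_decTerm (a : Fin v →₀ ℕ) (B : Finset (MVar v n)) :
    ∃ r : MvPolynomial (Fin v) ℤ, constantCoeff r = 1 ∧
      aeval (fun i => (1 - X i : MvPolynomial (Fin v) ℤ)) (decTerm a B) =
        r * monomial (rowCount B) 1 := by
  refine ⟨aeval (fun i => (1 - X i : MvPolynomial (Fin v) ℤ)) (monomial a (1 : ℤ)), ?_, ?_⟩
  · rw [aeval_monomial, map_mul, map_one, map_one, one_mul, Finsupp.prod, map_prod]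
    simp
  · have h : monomial (rowCount B) (1 : ℤ) = ∏ q ∈ B, X q.1 := by
      rw [rowCount, monomial_sum_one]
      rfl
    rw [decTerm, map_mul, map_prod, h]
    simp only [map_sub, map_one, aeval_X, sub_sub_cancel]

variable {κ κ' : Type} [Fintype κ] [Fintype κ']

theorem exists_rowCount_le_of_coeff_ne_zero (a : κ → Fin v →₀ ℕ) (B : κ → Finset (MVar v n))
    {d : Fin v →₀ ℕ} (hd : coeff d (aeval (fun i => (1 - X i : MvPolynomial (Fin v) ℤ))
      (∑ k, decTerm (a k) (B k))) ≠ 0) : ∃ k, rowCount (B k) ≤ d := by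
  rw [map_sum, coeff_sum] at hd
  obtain ⟨k, -, hk⟩ := Finset.exists_ne_zero_of_sum_ne_zero hd
  refine ⟨k, by_contra fun h => hk ?_⟩
  obtain ⟨r, -, hr⟩ := exists_aeval_decTerm (a k) (B k)
  rw [hr, coeff_mul_monomial', if_neg h]

theorem coeff_rowCount_ne_zero (a : κ → Fin v →₀ ℕ) (B : κ → Finset (MVar v n)) (k₀ : κ)
    (hmin : ∀ k, rowCount (B k) ≤ rowCount (B k₀) → rowCount (B k) = rowCount (B k₀)) :
    coeff (rowCount (B k₀)) (aeval (fun i => (1 - X i : MvPolynomial (Fin v) ℤ))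
      (∑ k, decTerm (a k) (B k))) ≠ 0 := by
  classical
  have h : ∀ k, coeff (rowCount (B k₀)) (aeval (fun i => (1 - X i : MvPolynomial (Fin v) ℤ))
      (decTerm (a k) (B k))) = if rowCount (B k) = rowCount (B k₀) then 1 else 0 := by
    intro k
    obtain ⟨r, hr1, hr⟩ := exists_aeval_decTerm (a k) (B k)
    rw [hr, coeff_mul_monomial']
    by_cases hk : rowCount (B k) = rowCount (B k₀)
    · rw [if_pos hk.le, if_pos hk, hk, tsub_self, mul_one]
      exact hr1
    · rw [if_neg fun h => hk (hmin k h), if_neg hk]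
  rw [map_sum, coeff_sum, Finset.sum_congr rfl fun k _ => h k, Finset.sum_boole]
  have : k₀ ∈ Finset.univ.filter fun k => rowCount (B k) = rowCount (B k₀) := by simp
  exact_mod_cast Finset.card_ne_zero_of_mem this

/-- The minimal row counts in two decompositions with the same numerator agree. -/
theorem exists_rowCount_eq (a : κ → Fin v →₀ ℕ) (B : κ → Finset (MVar v n))
    (a' : κ' → Fin v →₀ ℕ) (B' : κ' → Finset (MVar v n))
    (h : ∑ k, decTerm (a k) (B k) = ∑ k, decTerm (a' k) (B' k)) (k₀ : κ)
    (hmin : ∀ k, rowCount (B k) ≤ rowCount (B k₀) → rowCount (B k) = rowCount (B k₀)) :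
    ∃ k', rowCount (B' k') = rowCount (B k₀) := by
  have h0 := coeff_rowCount_ne_zero a B k₀ hmin
  rw [h] at h0
  obtain ⟨k₁, hk₁⟩ := exists_rowCount_le_of_coeff_ne_zero a' B' h0
  have hwf : WellFounded (Function.onFun (· < ·) fun k => rowCount (B' k)) :=
    InvImage.wf (fun k => rowCount (B' k)) wellFounded_lt
  let s : Set κ' := {k | rowCount (B' k) ≤ rowCount (B k₀)}
  have hs : s.Nonempty := ⟨k₁, hk₁⟩
  set k₂ := hwf.min s hs
  have hk₂ : rowCount (B' k₂) ≤ rowCount (B k₀) := hwf.min_mem s hs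
  have h2 := coeff_rowCount_ne_zero a' B' k₂ fun k hk => by
    by_contra hne
    exact hwf.not_lt_min s (show k ∈ s from hk.trans hk₂) (lt_of_le_of_ne hk hne)
  rw [← h] at h2
  obtain ⟨k₃, hk₃⟩ := exists_rowCount_le_of_coeff_ne_zero a B h2
  have h3 := hmin k₃ (hk₃.trans hk₂)
  exact ⟨k₂, le_antisymm hk₂ (h3 ▸ hk₃)⟩

/-- Among sets of variables whose rows are final segments, row counts of complements determine
inclusion. -/
theorem subset_of_rowCount_compl_le [DecidableEq (MVar v n)] {F F' : Finset (MVar v n)}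
    (hF : ∀ i k j, k < j → (⟨i, k⟩ : MVar v n) ∈ F → (⟨i, j⟩ : MVar v n) ∈ F)
    (hF' : ∀ i k j, k < j → (⟨i, k⟩ : MVar v n) ∈ F' → (⟨i, j⟩ : MVar v n) ∈ F')
    (h : rowCount F'ᶜ ≤ rowCount Fᶜ) : F ⊆ F' := by
  rintro ⟨i, j⟩ hj
  by_contra hj'
  have hsub : (Fᶜ.filter fun q => q.1 = i) ⊆ F'ᶜ.filter fun q => q.1 = i := by
    rintro ⟨i', k⟩ hk
    simp only [Finset.mem_filter, Finset.mem_compl] at hk ⊢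
    obtain ⟨hk, rfl⟩ := hk
    refine ⟨fun hk' => ?_, rfl⟩
    rcases lt_trichotomy k j with hlt | rfl | hlt
    · exact hj' (hF' _ _ _ hlt hk')
    · exact hk hj
    · exact hk (hF _ _ _ hlt hj)
  have heq := Finset.eq_of_subset_of_card_le hsub (by
    rw [← rowCount_apply, ← rowCount_apply]
    exact h i)
  have : (⟨i, j⟩ : MVar v n) ∈ F'ᶜ.filter fun q => q.1 = i := by simp [hj']
  rw [← heq] at this
  simp [hj] at this

end Types

section Borel

variable {K : Type} [Field K] {v : ℕ} {n : Fin v → ℕ}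

theorem gAct_X (g : ∀ i : Fin v, Matrix (Fin (n i + 1)) (Fin (n i + 1)) K) (p : MVar v n) :
    gAct g (X p) = ∑ k : Fin (n p.1 + 1), C (g p.1 k p.2) * X (⟨p.1, k⟩ : MVar v n) := by
  rw [gAct, aeval_X]

theorem BorelFixed.gAct_mem {J : Ideal (MvPolynomial (MVar v n) K)} (hJ : BorelFixed J)
    {g : ∀ i : Fin v, Matrix (Fin (n i + 1)) (Fin (n i + 1)) K} (hg : ∀ i, IsUnit (g i).det)
    (hu : ∀ (i : Fin v) (k j : Fin (n i + 1)), j < k → g i k j = 0)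
    {f : MvPolynomial (MVar v n) K} (hf : f ∈ J) : gAct g f ∈ J := by
  have := Ideal.mem_map_of_mem (gAct g) hf
  rwa [hJ g hg hu] at this

theorem gAct_comp (g h : ∀ i : Fin v, Matrix (Fin (n i + 1)) (Fin (n i + 1)) K) :
    (gAct g).comp (gAct h) = gAct (fun i => g i * h i) := by
  refine algHom_ext fun p => ?_
  simp only [AlgHom.comp_apply, gAct_X, map_sum, map_mul, algHom_C, algebraMap_eq,
    Matrix.mul_apply, Finset.mul_sum, Finset.sum_mul]
  rw [Finset.sum_comm]
  refine Finset.sum_congr rfl fun k _ => Finset.sum_congr rfl fun l _ => ?_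
  ring

theorem gAct_one : gAct (K := K) (fun i : Fin v => (1 : Matrix (Fin (n i + 1)) _ K)) =
    AlgHom.id K _ := by
  refine algHom_ext fun p => ?_
  rw [gAct_X, Finset.sum_eq_single p.2]
  · simp
  · intro k _ hk
    simp [Matrix.one_apply_ne hk]
  · simp

theorem borelFixed_of_gAct_mem {J : Ideal (MvPolynomial (MVar v n) K)}
    (h : ∀ g : ∀ i : Fin v, Matrix (Fin (n i + 1)) (Fin (n i + 1)) K,
      (∀ i, IsUnit (g i).det) → (∀ (i : Fin v) (k j : Fin (n i + 1)), j < k → g i k j = 0) →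
      ∀ f ∈ J, gAct g f ∈ J) : BorelFixed J := by
  intro g hg hu
  refine le_antisymm (Ideal.map_le_iff_le_comap.mpr fun f hf => h g hg hu f hf) fun f hf => ?_
  have hinv := h (fun i => (g i)⁻¹) (fun i => by
    rw [Matrix.det_nonsing_inv]
    exact (hg i).ringInverse) (fun i k j hjk => by
    have := (g i).invertibleOfIsUnitDet (hg i)
    have ht : (g i).BlockTriangular id := fun a b hab => hu i a b hab
    exact Matrix.blockTriangular_inv_of_blockTriangular ht hjk) f hf
  have hcomp : gAct g (gAct (fun i => (g i)⁻¹) f) = f := by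
    have := AlgHom.congr_fun (gAct_comp g fun i => (g i)⁻¹) f
    rw [AlgHom.comp_apply] at this
    rw [this]
    simp only [Matrix.mul_nonsing_inv _ (hg _)]
    rw [gAct_one, AlgHom.id_apply]
  rw [← hcomp]
  exact Ideal.mem_map_of_mem _ hinv

variable [Infinite K]

theorem BorelFixed.monomial_mem {J : Ideal (MvPolynomial (MVar v n) K)} (hJ : BorelFixed J)
    {f : MvPolynomial (MVar v n) K} (hf : f ∈ J) {m : MVar v n →₀ ℕ} (hm : m ∈ f.support) :
    monomial m (1 : K) ∈ J := by
  by_contra hmJ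
  obtain ⟨φ, hφm, hφ⟩ := Submodule.exists_le_ker_of_notMem
    (p := J.restrictScalars K) (v := monomial m (1 : K)) hmJ
  let P : MvPolynomial (MVar v n) K := ∑ u ∈ f.support, monomial u (coeff u f * φ (monomial u 1))
  have hP : P * ∏ q, X q = 0 := by
    refine funext fun lam => ?_
    rw [map_mul, map_prod, map_zero, mul_eq_zero]
    by_cases hlam : ∃ q, lam q = 0
    · obtain ⟨q, hq⟩ := hlam
      exact Or.inr (Finset.prod_eq_zero (Finset.mem_univ q) (by simpa using hq))
    · push Not at hlam
      left
      have hg := hJ.gAct_mem (g := fun i => Matrix.diagonal fun j => lam ⟨i, j⟩)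
        (fun i => by
          rw [Matrix.det_diagonal, isUnit_iff_ne_zero]
          exact Finset.prod_ne_zero_iff.mpr fun j _ => hlam _)
        (fun i k j hjk => Matrix.diagonal_apply_ne _ hjk.ne') hf
      have hX : ∀ q : MVar v n, gAct (fun i => Matrix.diagonal fun j => lam ⟨i, j⟩) (X q) =
          C (lam q) * X q := by
        intro q
        rw [gAct_X, Finset.sum_eq_single q.2]
        · simp
        · intro k _ hk
          simp [Matrix.diagonal_apply_ne _ hk]
        · simp
      have hmon : ∀ (u : MVar v n →₀ ℕ) (c : K),
          gAct (fun i => Matrix.diagonal fun j => lam ⟨i, j⟩) (monomial u c) =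
            (c * u.prod fun q e => lam q ^ e) • monomial u (1 : K) := by
        intro u c
        rw [monomial_eq, map_mul, algHom_C, Finsupp.prod, map_prod]
        simp only [map_pow, hX, mul_pow, Finset.prod_mul_distrib]
        rw [smul_eq_C_mul, monomial_eq, C_1, one_mul, C_mul, Finsupp.prod, Finsupp.prod, mul_assoc,
          algebraMap_eq, map_prod]
        simp only [map_pow]
      have h0 : φ (gAct (fun i => Matrix.diagonal fun j => lam ⟨i, j⟩) f) = 0 := hφ hg
      rw [f.as_sum, map_sum, map_sum] at h0
      rw [← h0]
      simp only [P, map_sum, hmon, map_smul, smul_eq_mul, eval_monomial]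
      exact Finset.sum_congr rfl fun u _ => by ring
  have hP0 : P = 0 := by
    rcases mul_eq_zero.mp hP with h | h
    · exact h
    · rw [Finset.prod_eq_zero_iff] at h
      obtain ⟨q, -, hq⟩ := h
      exact absurd hq (X_ne_zero q)
  have hc : coeff m P = coeff m f * φ (monomial m 1) := by
    classical
    simp only [P, coeff_sum, coeff_monomial]
    rw [Finset.sum_ite_eq' , if_pos hm]
  rw [hP0, coeff_zero] at hc
  exact (mul_ne_zero (mem_support_iff.mp hm) hφm) hc.symm

theorem BorelFixed.mem_iff {J : Ideal (MvPolynomial (MVar v n) K)} (hJ : BorelFixed J)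
    {f : MvPolynomial (MVar v n) K} : f ∈ J ↔ ∀ m ∈ f.support, monomial m (1 : K) ∈ J := by
  refine ⟨fun hf m hm => hJ.monomial_mem hf hm, fun h => ?_⟩
  rw [f.as_sum]
  refine J.sum_mem fun m hm => ?_
  rw [← mul_one (coeff m f), ← C_mul_monomial]
  exact J.mul_mem_left _ (h m hm)

theorem BorelFixed.isMultigraded {J : Ideal (MvPolynomial (MVar v n) K)} (hJ : BorelFixed J) :
    IsMultigraded J := by
  classical
  intro f hf a
  rw [hJ.mem_iff]
  intro m hm
  rw [mem_support_iff, coeff_weightedHomogeneousComponent] at hm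
  exact hJ.monomial_mem hf (mem_support_iff.mpr fun h => hm (by simp [h]))

theorem BorelFixed.stdExps_eq {Γ : Type} [AddCommMonoid Γ] [LinearOrder Γ]
    (θ : (MVar v n →₀ ℕ) →+ Γ) {J : Ideal (MvPolynomial (MVar v n) K)} (hJ : BorelFixed J) :
    stdExps θ J = {m | monomial m (1 : K) ∉ J} := by
  ext m
  refine not_congr ⟨?_, fun h => ⟨_, h, ?_⟩⟩
  · rintro ⟨f, hf, hm, -⟩
    exact hJ.monomial_mem hf hm
  · classical
    rw [IsLead, support_monomial, if_neg one_ne_zero]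
    simp

end Borel

section Faces

variable {K : Type} [Field K] {v : ℕ} {n : Fin v → ℕ}

/-- The faces of the simplicial complex of squarefree monomials outside `J`. -/
def IsFace (J : Ideal (MvPolynomial (MVar v n) K)) (F : Finset (MVar v n)) : Prop :=
  ∏ q ∈ F, X q ∉ J

theorem IsFace.mono {J : Ideal (MvPolynomial (MVar v n) K)} {F G : Finset (MVar v n)}
    (hF : IsFace J F) (h : G ⊆ F) : IsFace J G :=
  fun hG => hF (J.mem_of_dvd (Finset.prod_dvd_prod_of_subset _ _ _ h) hG)

theorem monomial_mem_iff_prod_support {σ : Type} {J : Ideal (MvPolynomial σ K)}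
    (hJ : J.IsRadical) (m : σ →₀ ℕ) :
    monomial m (1 : K) ∈ J ↔ ∏ q ∈ m.support, X q ∈ J := by
  rw [monomial_eq, C_1, one_mul, Finsupp.prod]
  refine ⟨fun h => hJ ⟨m.support.sup m, J.mem_of_dvd ?_ h⟩, fun h => J.mem_of_dvd ?_ h⟩
  · rw [← Finset.prod_pow]
    exact Finset.prod_dvd_prod_of_dvd _ _ fun q hq => pow_dvd_pow _ (Finset.le_sup hq)
  · exact Finset.prod_dvd_prod_of_dvd _ _ fun q hq =>
      dvd_pow_self _ (Finsupp.mem_support_iff.mp hq)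

theorem isFace_support_iff {J : Ideal (MvPolynomial (MVar v n) K)} (hJ : J.IsRadical)
    (m : MVar v n →₀ ℕ) : IsFace J m.support ↔ monomial m (1 : K) ∉ J :=
  (not_congr (monomial_mem_iff_prod_support hJ m)).symm

/-- The elementary unipotent matrices sending `x_{ij}` to `x_{ij} + x_{ik}`. -/
theorem BorelFixed.add_mem {J : Ideal (MvPolynomial (MVar v n) K)} (hB : BorelFixed J)
    {i : Fin v} {k j : Fin (n i + 1)} (hkj : k < j) {G : Finset (MVar v n)}
    (hG : (⟨i, j⟩ : MVar v n) ∉ G) (h : X ⟨i, j⟩ * ∏ q ∈ G, X q ∈ J) :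
    X ⟨i, k⟩ * ∏ q ∈ G, X q ∈ J := by
  classical
  let g : ∀ i : Fin v, Matrix (Fin (n i + 1)) (Fin (n i + 1)) K := fun i' a b =>
    if a = b then 1
    else if (⟨i', a⟩ : MVar v n) = ⟨i, k⟩ ∧ (⟨i', b⟩ : MVar v n) = ⟨i, j⟩ then 1 else 0
  have hg0 : ∀ (i' : Fin v) (a b : Fin (n i' + 1)), b < a → g i' a b = 0 := by
    intro i' a b hab
    simp only [g]
    rw [if_neg hab.ne', if_neg]
    rintro ⟨ha, hb⟩
    obtain ⟨rfl, ha⟩ := Sigma.mk.inj_iff.mp ha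
    obtain ⟨-, hb⟩ := Sigma.mk.inj_iff.mp hb
    cases ha
    cases hb
    exact absurd hab hkj.not_gt
  have hdet : ∀ i', IsUnit (g i').det := by
    intro i'
    rw [Matrix.det_of_isUpperTriangular (fun a b hab => hg0 i' a b hab)]
    simp [g]
  have hX : ∀ q : MVar v n, q ≠ ⟨i, j⟩ → gAct g (X q) = X q := by
    intro q hq
    rw [gAct_X, Finset.sum_eq_single q.2]
    · simp [g]
    · intro b _ hb
      rw [show g q.1 b q.2 = 0 from (if_neg hb).trans (if_neg fun h => hq h.2), C_0, zero_mul]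
    · simp
  have hXij : gAct g (X ⟨i, j⟩) = X ⟨i, j⟩ + X ⟨i, k⟩ := by
    rw [gAct_X, Finset.sum_eq_add j k hkj.ne']
    · simp [g, hkj.ne]
    · rintro b - ⟨hb, hb'⟩
      simp [g, hb, hb']
    · simp
    · simp
  have h1 := hB.gAct_mem hdet hg0 h
  rw [map_mul, map_prod, hXij, Finset.prod_congr rfl fun q hq => hX q fun e => hG (e ▸ hq),
    add_mul] at h1
  exact (J.add_mem_iff_right h).mp h1

theorem IsFace.insert {J : Ideal (MvPolynomial (MVar v n) K)} (hJ : J.IsRadical)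
    (hB : BorelFixed J) [DecidableEq (MVar v n)] {G : Finset (MVar v n)} (hG : IsFace J G)
    {i : Fin v} {k j : Fin (n i + 1)} (hkj : k < j) (hk : (⟨i, k⟩ : MVar v n) ∈ G) :
    IsFace J (insert ⟨i, j⟩ G) := by
  by_cases hj : (⟨i, j⟩ : MVar v n) ∈ G
  · rwa [Finset.insert_eq_self.mpr hj]
  · intro h
    rw [Finset.prod_insert hj] at h
    refine hG (hJ ⟨2, J.mem_of_dvd ?_ (hB.add_mem hkj hj h)⟩)
    rw [sq]
    exact mul_dvd_mul_right (Finset.dvd_prod_of_mem _ hk) _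

theorem exists_maximal_face {J : Ideal (MvPolynomial (MVar v n) K)} {G : Finset (MVar v n)}
    (hG : IsFace J G) : ∃ F, G ⊆ F ∧ Maximal (IsFace J) F :=
  (Set.toFinite {F | IsFace J F}).exists_le_maximal hG

theorem hser_support_eq (F : Finset (MVar v n)) [DecidableEq (MVar v n)] :
    hser {m : MVar v n →₀ ℕ | m.support = F} * denom v n = ↑(decTerm (rowCount F) Fᶜ) := by
  have h1 : {m : MVar v n →₀ ℕ | m.support = F} =
      (fun m => ∑ q ∈ F, Finsupp.single q 1 + m) ''
        (Set.univ ∩ {m : MVar v n →₀ ℕ | ∀ q ∈ Fᶜ, m q = 0}) := by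
    have hc : ∀ q, (∑ p ∈ F, Finsupp.single p 1 : MVar v n →₀ ℕ) q = if q ∈ F then 1 else 0 := by
      intro q
      rw [Finsupp.finsetSum_apply]
      simp [Finsupp.single_apply]
    ext m
    constructor
    · rintro rfl
      refine ⟨m - ∑ p ∈ m.support, Finsupp.single p 1, ⟨trivial, fun q hq => ?_⟩, ?_⟩
      · simp only [Finset.mem_compl, Finsupp.mem_support_iff, not_not] at hq
        simp [hq]
      · refine add_tsub_cancel_of_le fun q => ?_
        rw [hc]
        split_ifs with h
        · exact Nat.one_le_iff_ne_zero.mpr (Finsupp.mem_support_iff.mp h)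
        · exact Nat.zero_le _
    · rintro ⟨m, ⟨-, hm⟩, rfl⟩
      ext q
      rw [Finsupp.mem_support_iff, Finsupp.add_apply, hc]
      by_cases hq : q ∈ F
      · simp [hq]
      · simp [hq, hm q (by simpa using hq)]
  rw [h1, hser_shift, hser_inter_forall_of_invariant Fᶜ (by simp), mul_assoc, mul_assoc,
    hser_univ_mul_denom, mul_one, decTerm, map_sum]
  simp only [mdeg_single]
  rw [MvPolynomial.coe_mul, MvPolynomial.coe_monomial, rowCount]
  congr 1
  rw [← MvPolynomial.coeToMvPowerSeries.ringHom_apply, map_prod]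
  exact Finset.prod_congr rfl fun q _ => (coe_one_sub_X _).symm

theorem hser_mul_denom_eq_sum_faces {J : Ideal (MvPolynomial (MVar v n) K)} (hJ : J.IsRadical)
    [Fintype {F // IsFace J F}] [DecidableEq (MVar v n)] :
    hser {m : MVar v n →₀ ℕ | monomial m (1 : K) ∉ J} * denom v n =
      ↑(∑ F : {F // IsFace J F}, decTerm (rowCount F.1) F.1ᶜ) := by
  have h : {m : MVar v n →₀ ℕ | monomial m (1 : K) ∉ J} =
      ⋃ F ∈ (Finset.univ : Finset {F // IsFace J F}), {m | m.support = F.1} := by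
    ext m
    simp [← isFace_support_iff hJ]
  rw [h, hser_biUnion, Finset.sum_mul, ← MvPolynomial.coeToMvPowerSeries.ringHom_apply, map_sum]
  · exact Finset.sum_congr rfl fun F _ => hser_support_eq F.1
  · intro F F' hne
    rw [Set.disjoint_left]
    intro m hm hm'
    exact hne (Subtype.ext (hm.symm.trans hm'))

theorem rowCount_mono {B B' : Finset (MVar v n)} (h : B ⊆ B') : rowCount B ≤ rowCount B' := by
  intro i
  rw [rowCount_apply, rowCount_apply]
  exact Finset.card_le_card (Finset.filter_subset_filter _ h)

/-- If the numerator of the Hilbert series of `S/J` involves at most `c i` factors `1 - y_i` per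
summand, then every face of the radical Borel fixed ideal `J` lies in a face containing all but
the first `c i` variables of each row `i`. -/
theorem IsFace.exists_superset {J : Ideal (MvPolynomial (MVar v n) K)} (hJ : J.IsRadical)
    (hB : BorelFixed J) {A : Finset (MVar v n)} {p : MvPolynomial (Fin v) ℤ} (hp : HasDec A p)
    (hJp : hser {m : MVar v n →₀ ℕ | monomial m (1 : K) ∉ J} * denom v n = p)
    {G : Finset (MVar v n)} (hG : IsFace J G) :
    ∃ F, IsFace J F ∧ G ⊆ F ∧
      ∀ (i : Fin v) (j : Fin (n i + 1)), rowCount A i ≤ j → (⟨i, j⟩ : MVar v n) ∈ F := by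
  classical
  obtain ⟨F, hGF, hF⟩ := exists_maximal_face hG
  have hup : ∀ {F}, Maximal (IsFace J) F → ∀ i k j, k < j → (⟨i, k⟩ : MVar v n) ∈ F →
      (⟨i, j⟩ : MVar v n) ∈ F := fun {F} hF i k j hkj hk =>
    hF.le_of_ge (hF.prop.insert hJ hB hkj hk) (Finset.subset_insert _ _)
      (Finset.mem_insert_self _ _)
  obtain ⟨κ, _, a, B, hBA, rfl⟩ := hp
  rw [hser_mul_denom_eq_sum_faces hJ, MvPolynomial.coe_inj] at hJp
  obtain ⟨k, hk⟩ := exists_rowCount_eq (fun F : {F // IsFace J F} => rowCount F.1)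
    (fun F => F.1ᶜ) a B hJp ⟨F, hF.prop⟩ fun H hH => by
      obtain ⟨H', hHH', hH'⟩ := exists_maximal_face H.2
      have hle : rowCount H'ᶜ ≤ rowCount H.1ᶜ := rowCount_mono (Finset.compl_subset_compl.mpr hHH')
      have hsub := subset_of_rowCount_compl_le (hup hF) (hup hH') (hle.trans hH)
      have := hF.le_of_ge hH'.prop hsub
      exact le_antisymm hH (rowCount_mono (Finset.compl_subset_compl.mpr (hHH'.trans this)))
  refine ⟨F, hF.prop, hGF, fun i j hj => ?_⟩
  by_contra hjF
  have hle : rowCount Fᶜ i ≤ rowCount A i := hk ▸ rowCount_mono (hBA k) i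
  have hsub : (Finset.Iic j).map (Function.Embedding.sigmaMk (β := fun i => Fin (n i + 1)) i) ⊆
      Fᶜ.filter fun q => q.1 = i := by
    intro q hq
    simp only [Finset.mem_map, Finset.mem_Iic, Function.Embedding.sigmaMk_apply] at hq
    obtain ⟨l, hl, rfl⟩ := hq
    simp only [Finset.mem_filter, Finset.mem_compl, and_true]
    rcases hl.eq_or_lt with rfl | hl
    · exact hjF
    · exact fun h => hjF (hup hF _ _ _ hl h)
  have := Finset.card_le_card hsub
  rw [← rowCount_apply, Finset.card_map, Fin.card_Iic] at this
  omega

end Faces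

section Ideals

variable {σ τ K : Type} [Field K]

/-- A subspace closed under multiplication by variables absorbs the extension of any ideal whose
image it contains. -/
theorem mem_of_mem_map {φ : MvPolynomial σ K →ₐ[K] MvPolynomial τ K}
    {I : Ideal (MvPolynomial σ K)} (P : Submodule K (MvPolynomial τ K))
    (hX : ∀ q, ∀ f ∈ P, X q * f ∈ P) (hI : ∀ f ∈ I, φ f ∈ P) {f : MvPolynomial τ K}
    (hf : f ∈ Ideal.map φ I) : f ∈ P := by
  have hmul : ∀ g : MvPolynomial τ K, ∀ f ∈ P, g * f ∈ P := by
    intro g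
    induction g using MvPolynomial.induction_on with
    | C a =>
      intro f hf
      rw [← smul_eq_C_mul]
      exact P.smul_mem a hf
    | add p q hp hq =>
      intro f hf
      rw [add_mul]
      exact P.add_mem (hp f hf) (hq f hf)
    | mul_X p q hp =>
      intro f hf
      rw [mul_assoc]
      exact hp _ (hX q f hf)
  let J : Ideal (MvPolynomial τ K) :=
    { P.toAddSubmonoid with smul_mem' := fun g f hf => hmul g f hf }
  exact (Ideal.map_le_iff_le_comap.mpr fun f hf => hI f hf : Ideal.map φ I ≤ J) hf

variable {ι : σ → τ}

theorem mapDomain_comapDomain_le (hι : Function.Injective ι) (m : τ →₀ ℕ) :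
    (m.comapDomain ι hι.injOn).mapDomain ι ≤ m := by
  intro q
  by_cases hq : q ∈ Set.range ι
  · obtain ⟨q, rfl⟩ := hq
    rw [Finsupp.mapDomain_apply hι, Finsupp.comapDomain_apply]
  · rw [Finsupp.mapDomain_of_notMem_range _ _ hq]
    exact Nat.zero_le _

theorem mapDomain_add_apply_of_forall_eq_zero (hι : Function.Injective ι) {w : τ →₀ ℕ}
    (hw : ∀ q, w (ι q) = 0) (u : σ →₀ ℕ)
    (q : σ) : (u.mapDomain ι + w) (ι q) = u q := by
  rw [Finsupp.add_apply, Finsupp.mapDomain_apply hι, hw, add_zero]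

theorem comapDomain_mapDomain_add (hι : Function.Injective ι) {w : τ →₀ ℕ}
    (hw : ∀ q, w (ι q) = 0) (u : σ →₀ ℕ) :
    (u.mapDomain ι + w).comapDomain ι hι.injOn = u := by
  ext q
  rw [Finsupp.comapDomain_apply, mapDomain_add_apply_of_forall_eq_zero hι hw]

theorem exists_eq_mapDomain_add (hι : Function.Injective ι) (m : τ →₀ ℕ) :
    ∃ w : τ →₀ ℕ, (∀ q, w (ι q) = 0) ∧
    m = (m.comapDomain ι hι.injOn).mapDomain ι + w := by
  refine ⟨m - (m.comapDomain ι hι.injOn).mapDomain ι, fun q => ?_,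
    (add_tsub_cancel_of_le (mapDomain_comapDomain_le hι m)).symm⟩
  rw [Finsupp.tsub_apply, Finsupp.mapDomain_apply hι, Finsupp.comapDomain_apply, tsub_self]

/-- The coefficients of an element of the extended ideal with respect to the monomials in the new
variables lie in the original ideal. -/
theorem exists_coeff_of_mem_map_rename (hι : Function.Injective ι)
    {I : Ideal (MvPolynomial σ K)} {f : MvPolynomial τ K}
    (hf : f ∈ Ideal.map (rename ι) I) {w : τ →₀ ℕ} (hw : ∀ q, w (ι q) = 0) :
    ∃ g ∈ I, ∀ u, coeff u g = coeff (u.mapDomain ι + w) f := by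
  classical
  let P : Submodule K (MvPolynomial τ K) :=
    { carrier := {f | ∀ w : τ →₀ ℕ, (∀ q, w (ι q) = 0) →
        ∃ g ∈ I, ∀ u, coeff u g = coeff (u.mapDomain ι + w) f}
      add_mem' := by
        intro f f' hf hf' w hw
        obtain ⟨g, hg, h⟩ := hf w hw
        obtain ⟨g', hg', h'⟩ := hf' w hw
        exact ⟨g + g', I.add_mem hg hg', fun u => by rw [coeff_add, coeff_add, h, h']⟩
      zero_mem' := fun w _ => ⟨0, I.zero_mem, fun u => by simp⟩
      smul_mem' := by
        intro c f hf w hw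
        obtain ⟨g, hg, h⟩ := hf w hw
        exact ⟨C c * g, I.mul_mem_left _ hg, fun u => by
          rw [coeff_C_mul, coeff_smul, h, smul_eq_mul]⟩ }
  have hP : ∀ q, ∀ f ∈ P, X q * f ∈ P := by
    intro p f hf w hw
    by_cases hp : p ∈ Set.range ι
    · obtain ⟨p, rfl⟩ := hp
      obtain ⟨g, hg, h⟩ := hf w hw
      refine ⟨X p * g, I.mul_mem_left _ hg, fun u => ?_⟩
      rw [coeff_X_mul', coeff_X_mul']
      refine ite_congr (propext ?_) (fun hu => ?_) fun _ => rfl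
      · rw [Finsupp.mem_support_iff, Finsupp.mem_support_iff,
          mapDomain_add_apply_of_forall_eq_zero hι hw]
      rw [Finsupp.mem_support_iff, mapDomain_add_apply_of_forall_eq_zero hι hw] at hu
      rw [h]
      congr 1
      obtain ⟨u, rfl⟩ := exists_add_of_le
        (Finsupp.single_le_iff.mpr (Nat.one_le_iff_ne_zero.mpr hu))
      rw [add_tsub_cancel_left, Finsupp.mapDomain_add, Finsupp.mapDomain_single, add_assoc,
        add_tsub_cancel_left]
    · have hmap : ∀ u : σ →₀ ℕ, u.mapDomain ι p = 0 :=
        fun u => Finsupp.mapDomain_of_notMem_range _ _ hp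
      by_cases hwp : w p = 0
      · refine ⟨0, I.zero_mem, fun u => ?_⟩
        rw [coeff_X_mul', if_neg, coeff_zero]
        simp [hmap, hwp]
      · obtain ⟨w, rfl⟩ := exists_add_of_le
          (Finsupp.single_le_iff.mpr (Nat.one_le_iff_ne_zero.mpr hwp))
        obtain ⟨g, hg, h⟩ := hf w fun q => (Nat.add_eq_zero_iff.mp (hw q)).2
        refine ⟨g, hg, fun u => ?_⟩
        rw [coeff_X_mul', if_pos (by simp), h, add_left_comm, add_tsub_cancel_left]
  refine mem_of_mem_map P hP (fun g hg w hw => ?_) hf w hw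
  by_cases hw0 : w = 0
  · subst hw0
    exact ⟨g, hg, fun u => by rw [add_zero, coeff_rename_mapDomain _ hι]⟩
  · refine ⟨0, I.zero_mem, fun u => ?_⟩
    rw [coeff_zero, coeff_rename_eq_zero]
    intro u' hu'
    refine absurd ?_ hw0
    ext q
    by_cases hq : q ∈ Set.range ι
    · obtain ⟨q, rfl⟩ := hq
      exact hw q
    · have := DFunLike.congr_fun hu' q
      rw [Finsupp.add_apply, Finsupp.mapDomain_of_notMem_range _ _ hq,
        Finsupp.mapDomain_of_notMem_range _ _ hq, zero_add] at this
      exact this.symm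

variable (hι : Function.Injective ι)

theorem monomial_mem_map_rename_iff {I : Ideal (MvPolynomial σ K)} (m : τ →₀ ℕ) :
    monomial m (1 : K) ∈ Ideal.map (rename ι) I ↔
      monomial (m.comapDomain ι hι.injOn) (1 : K) ∈ I := by
  classical
  obtain ⟨w, hw, hm⟩ := exists_eq_mapDomain_add hι m
  constructor
  · intro h
    obtain ⟨g, hg, hgu⟩ := exists_coeff_of_mem_map_rename hι h hw
    convert hg using 1
    ext u
    rw [hgu, coeff_monomial, coeff_monomial]
    refine if_congr ⟨?_, ?_⟩ rfl rfl
    · rintro rfl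
      exact hm
    · rintro rfl
      exact comapDomain_mapDomain_add hι hw u
  · intro h
    have := Ideal.mul_mem_left _ (monomial w (1 : K)) (Ideal.mem_map_of_mem (rename ι) h)
    rwa [rename_monomial, monomial_mul, one_mul, add_comm, ← hm] at this

variable {Γ : Type} [AddCommMonoid Γ] [LinearOrder Γ]

theorem stdExps_map_rename [IsOrderedCancelAddMonoid Γ] (θ : (τ →₀ ℕ) →+ Γ)
    (I : Ideal (MvPolynomial σ K)) :
    stdExps θ (Ideal.map (rename ι) I) = {m | m.comapDomain ι hι.injOn ∈
      stdExps (θ.comp (Finsupp.mapDomain.addMonoidHom ι)) I} := by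
  ext m
  obtain ⟨w, hw, hm⟩ := exists_eq_mapDomain_add hι m
  refine not_congr ⟨?_, ?_⟩
  · rintro ⟨f, hf, hfm, hmax⟩
    obtain ⟨g, hg, h⟩ := exists_coeff_of_mem_map_rename hι hf hw
    refine ⟨g, hg, ?_, fun u hu => ?_⟩
    · rwa [mem_support_iff, h, ← hm, ← mem_support_iff]
    · rw [mem_support_iff, h, ← mem_support_iff] at hu
      have := hmax _ hu
      rw [map_add, (congrArg θ hm).trans (map_add θ _ w)] at this
      exact le_of_add_le_add_right this
  · rintro ⟨g, hg, hgm, hmax⟩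
    refine ⟨monomial w 1 * rename ι g, Ideal.mul_mem_left _ _ (Ideal.mem_map_of_mem _ hg), ?_, ?_⟩
    · rw [mem_support_iff, hm, add_comm, coeff_monomial_mul, one_mul,
        coeff_rename_mapDomain _ hι]
      exact mem_support_iff.mp hgm
    · intro u hu
      rw [mem_support_iff, coeff_monomial_mul'] at hu
      split_ifs at hu with hwu
      · rw [one_mul] at hu
        obtain ⟨u', hu', hne⟩ := coeff_rename_ne_zero _ _ _ hu
        have := hmax u' (mem_support_iff.mpr hne)
        rw [← tsub_add_cancel_of_le hwu, ← hu', hm, map_add, map_add]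
        exact add_le_add_left this _
      · exact absurd rfl hu

theorem stdExps_comap_killCompl (θ : (τ →₀ ℕ) →+ Γ) (I : Ideal (MvPolynomial σ K)) :
    stdExps θ (Ideal.comap (killCompl hι) I) = Finsupp.mapDomain ι ''
      stdExps (θ.comp (Finsupp.mapDomain.addMonoidHom ι)) I := by
  classical
  ext m
  constructor
  · intro hm
    by_cases hs : ↑m.support ⊆ Set.range ι
    · refine ⟨m.comapDomain ι hι.injOn, ?_, Finsupp.mapDomain_comapDomain ι hι m hs⟩
      rintro ⟨g, hg, hgm, hmax⟩
      refine hm ⟨rename ι g, ?_, ?_, fun u hu => ?_⟩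
      · rwa [Ideal.mem_comap, killCompl_rename_app]
      · rw [← Finsupp.mapDomain_comapDomain ι hι m hs, mem_support_iff,
          coeff_rename_mapDomain _ hι]
        exact mem_support_iff.mp hgm
      · obtain ⟨u', rfl, hne⟩ := coeff_rename_ne_zero _ _ _ (mem_support_iff.mp hu)
        have := hmax u' (mem_support_iff.mpr hne)
        simpa [Finsupp.mapDomain_comapDomain ι hι m hs] using this
    · refine absurd ⟨monomial m 1, ?_, ?_⟩ hm
      · rw [Ideal.mem_comap, killCompl_monomial_eq_zero_of_not_subset hι _ hs]
        exact I.zero_mem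
      · rw [IsLead, support_monomial, if_neg one_ne_zero]
        simp
  · rintro ⟨u, hu, rfl⟩ ⟨f, hf, hfm, hmax⟩
    refine hu ⟨killCompl hι f, hf, ?_, fun u' hu' => ?_⟩
    · rw [mem_support_iff, coeff_killCompl]
      exact mem_support_iff.mp hfm
    · rw [mem_support_iff, coeff_killCompl, ← mem_support_iff] at hu'
      exact hmax _ hu'

theorem map_rename_sup_span_eq_comap (I : Ideal (MvPolynomial σ K)) :
    Ideal.map (rename ι) I ⊔
      Ideal.span {f : MvPolynomial τ K | ∃ q : τ, q ∉ Set.range ι ∧ f = X q} =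
    Ideal.comap (killCompl hι) I := by
  set Z := Ideal.span {f : MvPolynomial τ K | ∃ q : τ, q ∉ Set.range ι ∧ f = X q}
  refine le_antisymm (sup_le (Ideal.map_le_iff_le_comap.mpr fun f hf => ?_)
    (Ideal.span_le.mpr ?_)) fun f hf => ?_
  · rwa [Ideal.mem_comap, Ideal.mem_comap, killCompl_rename_app]
  · rintro _ ⟨q, hq, rfl⟩
    rw [SetLike.mem_coe, Ideal.mem_comap, X,
      killCompl_monomial_eq_zero_of_notMem_range hι 1 (a := q) (by simp) hq]
    exact I.zero_mem
  · have key : ∀ f : MvPolynomial τ K, f - rename ι (killCompl hι f) ∈ Z := by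
      intro f
      induction f using MvPolynomial.induction_on' with
      | monomial m c =>
        by_cases hs : ↑m.support ⊆ Set.range ι
        · rw [killCompl_monomial_eq_monomial_comapDomain_of_subset hι _ hs, rename_monomial,
            Finsupp.mapDomain_comapDomain ι hι m hs, sub_self]
          exact Z.zero_mem
        · rw [killCompl_monomial_eq_zero_of_not_subset hι _ hs, map_zero, sub_zero]
          obtain ⟨q, hq, hqι⟩ := Set.not_subset.mp hs
          refine Z.mem_of_dvd (X_dvd_monomial.mpr (Or.inr ?_)) (Ideal.subset_span ⟨q, hqι, rfl⟩)
          exact Finsupp.mem_support_iff.mp hq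
      | add p q hp hq =>
        rw [map_add, map_add, add_sub_add_comm]
        exact Z.add_mem hp hq
    rw [← sub_add_cancel f (rename ι (killCompl hι f))]
    exact Ideal.add_mem _ (Ideal.mem_sup_right (key f))
      (Ideal.mem_sup_left (Ideal.mem_map_of_mem _ hf))

end Ideals

section Multigraded

variable {K : Type} [Field K] {v : ℕ} {n n' : Fin v → ℕ}

theorem weightedHomogeneousComponent_monomial [DecidableEq (Fin v → ℕ)] (a : Fin v → ℕ)
    (m : MVar v n →₀ ℕ) (c : K) : weightedHomogeneousComponent (wt v n) a (monomial m c) =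
      if Finsupp.weight (wt v n) m = a then monomial m c else 0 := by
  classical
  ext u
  rw [coeff_weightedHomogeneousComponent, coeff_monomial]
  by_cases h : m = u
  · subst h
    split_ifs <;> simp_all
  · split_ifs <;> simp [h]

variable {ι : MVar v n → MVar v n'}

theorem mdeg_mapDomain (hdeg : ∀ p, (ι p).1 = p.1) (m : MVar v n →₀ ℕ) :
    mdeg v n' (m.mapDomain ι) = mdeg v n m := by
  rw [mdeg, mdeg, Finsupp.mapDomain.addMonoidHom_apply, Finsupp.mapDomain.addMonoidHom_apply,
    ← Finsupp.mapDomain_comp]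
  exact Finsupp.mapDomain_congr fun p _ => hdeg p

theorem weight_mapDomain (hdeg : ∀ p, (ι p).1 = p.1) (m : MVar v n →₀ ℕ) :
    Finsupp.weight (wt v n') (m.mapDomain ι) = Finsupp.weight (wt v n) m := by
  rw [weight_wt, weight_wt, mdeg_mapDomain hdeg]

theorem weightedHomogeneousComponent_rename (hdeg : ∀ p, (ι p).1 = p.1) (a : Fin v → ℕ)
    (f : MvPolynomial (MVar v n) K) : weightedHomogeneousComponent (wt v n') a (rename ι f) =
      rename ι (weightedHomogeneousComponent (wt v n) a f) := by
  classical
  induction f using MvPolynomial.induction_on' with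
  | monomial m c =>
    rw [rename_monomial, weightedHomogeneousComponent_monomial,
      weightedHomogeneousComponent_monomial, weight_mapDomain hdeg]
    split_ifs
    · rw [rename_monomial]
    · rw [map_zero]
  | add p q hp hq => simp only [map_add, hp, hq]

theorem weightedHomogeneousComponent_killCompl (hι : Function.Injective ι)
    (hdeg : ∀ p, (ι p).1 = p.1) (a : Fin v → ℕ) (f : MvPolynomial (MVar v n') K) :
    weightedHomogeneousComponent (wt v n) a (killCompl hι f) =
      killCompl hι (weightedHomogeneousComponent (wt v n') a f) := by
  classical
  ext m
  rw [coeff_weightedHomogeneousComponent, coeff_killCompl, coeff_killCompl,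
    coeff_weightedHomogeneousComponent, weight_mapDomain hdeg]

theorem IsMultigraded.comap_killCompl {I : Ideal (MvPolynomial (MVar v n) K)}
    (hI : IsMultigraded I) (hι : Function.Injective ι) (hdeg : ∀ p, (ι p).1 = p.1) :
    IsMultigraded (Ideal.comap (killCompl hι) I) := by
  intro f hf a
  rw [Ideal.mem_comap, ← weightedHomogeneousComponent_killCompl hι hdeg]
  exact hI _ hf a

theorem weightedHomogeneousComponent_X_mul (q : MVar v n) (a : Fin v → ℕ)
    (f : MvPolynomial (MVar v n) K) :
    ∃ b, weightedHomogeneousComponent (wt v n) a (X q * f) =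
      X q * weightedHomogeneousComponent (wt v n) b f ∨
      weightedHomogeneousComponent (wt v n) a (X q * f) = 0 := by
  classical
  have hw : ∀ m : MVar v n →₀ ℕ, Finsupp.weight (wt v n) (Finsupp.single q 1 + m) =
      wt v n q + Finsupp.weight (wt v n) m := fun m => by
    rw [map_add, Finsupp.weight_single, one_smul]
  by_cases ha : ∃ b, a = wt v n q + b
  · obtain ⟨b, rfl⟩ := ha
    refine ⟨b, Or.inl ?_⟩
    induction f using MvPolynomial.induction_on' with
    | monomial m c =>
      rw [X, monomial_mul, one_mul, weightedHomogeneousComponent_monomial,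
        weightedHomogeneousComponent_monomial, hw]
      simp only [add_right_inj, mul_ite, mul_zero, monomial_mul, one_mul]
    | add p p' hp hp' => simp only [map_add, mul_add, hp, hp']
  · refine ⟨0, Or.inr ?_⟩
    induction f using MvPolynomial.induction_on' with
    | monomial m c =>
      rw [X, monomial_mul, weightedHomogeneousComponent_monomial, hw, if_neg]
      exact fun h => ha ⟨_, h.symm⟩
    | add p p' hp hp' => rw [mul_add, map_add, hp, hp', add_zero]

theorem IsMultigraded.map_rename {I : Ideal (MvPolynomial (MVar v n) K)}
    (hI : IsMultigraded I) (hdeg : ∀ p, (ι p).1 = p.1) :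
    IsMultigraded (Ideal.map (rename ι) I) := by
  intro f hf
  let P : Submodule K (MvPolynomial (MVar v n') K) :=
    { carrier := {f | ∀ a, weightedHomogeneousComponent (wt v n') a f ∈ Ideal.map (rename ι) I}
      add_mem' := fun hf hf' a => by
        rw [map_add]
        exact Ideal.add_mem _ (hf a) (hf' a)
      zero_mem' := fun a => by
        rw [map_zero]
        exact Ideal.zero_mem _
      smul_mem' := fun c f hf a => by
        rw [map_smul, smul_eq_C_mul]
        exact Ideal.mul_mem_left _ _ (hf a) }
  refine mem_of_mem_map P (fun q f hf a => ?_) (fun g hg a => ?_) hf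
  · obtain ⟨b, h | h⟩ := weightedHomogeneousComponent_X_mul q a f
    · rw [h]
      exact Ideal.mul_mem_left _ _ (hf b)
    · rw [h]
      exact Ideal.zero_mem _
  · rw [weightedHomogeneousComponent_rename hdeg]
    exact Ideal.mem_map_of_mem _ (hI g hg a)

end Multigraded

section HilbertSeries

variable {v : ℕ} {n n' : Fin v → ℕ}

theorem hser_comapDomain_mul_denom {ι : MVar v n → MVar v n'} (hι : Function.Injective ι)
    (hdeg : ∀ p, (ι p).1 = p.1) (T : Set (MVar v n →₀ ℕ)) :
    hser {m : MVar v n' →₀ ℕ | m.comapDomain ι hι.injOn ∈ T} * denom v n' =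
      hser T * denom v n := by
  classical
  set T' := {m : MVar v n' →₀ ℕ | m.comapDomain ι hι.injOn ∈ T}
  have hinv : ∀ q ∈ (Finset.univ.image ι)ᶜ, ∀ m, Finsupp.single q 1 + m ∈ T' ↔ m ∈ T' := by
    intro q hq m
    have hq' : q ∉ Set.range ι := by simpa using hq
    simp only [T', Set.mem_ofPred_eq]
    rw [Finsupp.comapDomain_add_of_injective hι, Finsupp.comapDomain_single_of_not_mem_range hq',
      zero_add]
  have himage : T' ∩ {m | ∀ q ∈ (Finset.univ.image ι)ᶜ, m q = 0} = Finsupp.mapDomain ι '' T := by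
    ext m
    constructor
    · rintro ⟨hm, h0⟩
      refine ⟨_, hm, Finsupp.mapDomain_comapDomain ι hι m fun q hq => ?_⟩
      by_contra hq'
      exact Finsupp.mem_support_iff.mp hq (h0 q (by simpa using hq'))
    · rintro ⟨u, hu, rfl⟩
      refine ⟨?_, fun q hq => Finsupp.mapDomain_of_notMem_range _ _ (by simpa using hq)⟩
      simpa only [T', Set.mem_ofPred_eq, Finsupp.comapDomain_mapDomain ι hι] using hu
  have hden : denom v n' = (∏ q ∈ (Finset.univ.image ι)ᶜ, (1 - MvPowerSeries.X q.1)) *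
      denom v n := by
    rw [denom, ← Finset.prod_compl_mul_prod (Finset.univ.image ι), Finset.prod_image hι.injOn,
      denom]
    simp only [hdeg]
  have h := hser_inter_forall_of_invariant _ hinv
  rw [himage, hser_image T _ (Finsupp.mapDomain_injective hι) (mdeg_mapDomain hdeg)] at h
  rw [hden, h]
  ring

theorem exists_injective_orderedAddMonoid (v : ℕ) (n : Fin v → ℕ) :
    ∃ (Γ : Type) (_ : AddCommMonoid Γ) (_ : LinearOrder Γ) (_ : IsOrderedCancelAddMonoid Γ)
      (θ : (MVar v n →₀ ℕ) →+ Γ), Function.Injective θ := by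
  let e := Fintype.equivFin (MVar v n)
  let M : MonomialOrder (Fin (Fintype.card (MVar v n))) := MonomialOrder.lex
  exact ⟨M.syn, inferInstance, inferInstance, inferInstance,
    M.toSyn.toAddMonoidHom.comp (Finsupp.mapDomain.addMonoidHom e),
    M.toSyn.injective.comp (Finsupp.mapDomain_injective e.injective)⟩

variable {K : Type} [Field K] {ι ι' : MVar v n → MVar v n'}

theorem injective_comp_mapDomain {Γ : Type} [AddCommMonoid Γ] {θ : (MVar v n' →₀ ℕ) →+ Γ}
    (hθ : Function.Injective θ) (hι : Function.Injective ι) :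
    Function.Injective (θ.comp (Finsupp.mapDomain.addMonoidHom ι)) :=
  hθ.comp (Finsupp.mapDomain_injective hι)

theorem sameHS_map_rename_iff (hι : Function.Injective ι) (hdeg : ∀ p, (ι p).1 = p.1)
    (hι' : Function.Injective ι') (hdeg' : ∀ p, (ι' p).1 = p.1)
    {I J : Ideal (MvPolynomial (MVar v n) K)} (hI : IsMultigraded I) (hJ : IsMultigraded J) :
    sameHS (Ideal.map (rename ι) I) (Ideal.map (rename ι') J) ↔ sameHS I J := by
  obtain ⟨Γ, _, _, _, θ, hθ⟩ := exists_injective_orderedAddMonoid v n'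
  rw [sameHS_iff_hser (injective_comp_mapDomain hθ hι) (injective_comp_mapDomain hθ hι') hI hJ,
    sameHS_iff_hser hθ hθ (hI.map_rename hdeg) (hJ.map_rename hdeg'), stdExps_map_rename hι,
    stdExps_map_rename hι', ← mul_left_inj' (denom_ne_zero (v := v) (n := n')),
    hser_comapDomain_mul_denom hι hdeg, hser_comapDomain_mul_denom hι' hdeg',
    mul_left_inj' denom_ne_zero]

theorem sameHS_comap_killCompl_iff (hι : Function.Injective ι) (hdeg : ∀ p, (ι p).1 = p.1)
    (hι' : Function.Injective ι') (hdeg' : ∀ p, (ι' p).1 = p.1)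
    {I J : Ideal (MvPolynomial (MVar v n) K)} (hI : IsMultigraded I) (hJ : IsMultigraded J) :
    sameHS (Ideal.comap (killCompl hι) I) (Ideal.comap (killCompl hι') J) ↔ sameHS I J := by
  obtain ⟨Γ, _, _, _, θ, hθ⟩ := exists_injective_orderedAddMonoid v n'
  rw [sameHS_iff_hser (injective_comp_mapDomain hθ hι) (injective_comp_mapDomain hθ hι') hI hJ,
    sameHS_iff_hser hθ hθ (hI.comap_killCompl hι hdeg) (hJ.comap_killCompl hι' hdeg'),
    stdExps_comap_killCompl, stdExps_comap_killCompl,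
    hser_image _ _ (Finsupp.mapDomain_injective hι) (mdeg_mapDomain hdeg),
    hser_image _ _ (Finsupp.mapDomain_injective hι') (mdeg_mapDomain hdeg')]

end HilbertSeries

section Radical

variable {σ τ K : Type} [Field K]

theorem isRadical_of_monomial {J : Ideal (MvPolynomial σ K)}
    (h1 : ∀ f ∈ J, ∀ m ∈ f.support, monomial m (1 : K) ∈ J)
    (h2 : ∀ m, monomial m (1 : K) ∈ J → ∏ q ∈ m.support, X q ∈ J) : J.IsRadical := by
  rintro f ⟨k, hk⟩
  rw [f.as_sum]
  refine J.sum_mem fun m hm => ?_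
  rw [← mul_one (coeff m f), ← C_mul_monomial]
  refine J.mul_mem_left _ (by_contra fun hmJ => ?_)
  have hinj : Function.Injective ((↑) : m.support → σ) := Subtype.val_injective
  have hmr : Finsupp.mapDomain (↑) (m.comapDomain ((↑) : m.support → σ) hinj.injOn) = m :=
    Finsupp.mapDomain_comapDomain _ hinj m fun q hq => ⟨⟨q, hq⟩, rfl⟩
  have hne : killCompl hinj f ≠ 0 := by
    rw [MvPolynomial.ne_zero_iff]
    refine ⟨m.comapDomain _ hinj.injOn, ?_⟩
    rw [coeff_killCompl, hmr]
    exact mem_support_iff.mp hm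
  have hne' := pow_ne_zero k hne
  rw [← map_pow, MvPolynomial.ne_zero_iff] at hne'
  obtain ⟨s, hs⟩ := hne'
  rw [coeff_killCompl] at hs
  have := h2 _ (h1 _ hk _ (mem_support_iff.mpr hs))
  refine hmJ (J.mem_of_dvd ?_ this)
  classical
  rw [monomial_eq, C_1, one_mul, Finsupp.prod]
  refine (Finset.prod_dvd_prod_of_subset _ _ _ fun q hq => ?_).trans
    (Finset.prod_dvd_prod_of_dvd _ _ fun q hq =>
      dvd_pow_self (X q) (Finsupp.mem_support_iff.mp hq))
  obtain ⟨p, -, rfl⟩ := Finset.mem_image.mp (Finsupp.mapDomain_support hq)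
  exact p.2

theorem isRadical_map_rename {ι : σ → τ} (hι : Function.Injective ι)
    {J : Ideal (MvPolynomial σ K)} (hJ : J.IsRadical)
    (hmon : ∀ f ∈ J, ∀ m ∈ f.support, monomial m (1 : K) ∈ J) :
    (Ideal.map (rename ι) J).IsRadical := by
  classical
  refine isRadical_of_monomial (fun f hf m hm => ?_) fun m hm => ?_
  · obtain ⟨w, hw, hmw⟩ := exists_eq_mapDomain_add hι m
    obtain ⟨g, hg, h⟩ := exists_coeff_of_mem_map_rename hι hf hw
    rw [monomial_mem_map_rename_iff hι]
    refine hmon g hg _ ?_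
    rwa [mem_support_iff, h, ← hmw, ← mem_support_iff]
  · rw [monomial_mem_map_rename_iff hι, monomial_mem_iff_prod_support hJ] at hm
    refine Ideal.mem_of_dvd _ ?_ (Ideal.mem_map_of_mem (rename ι) hm)
    simp only [map_prod, rename_X]
    rw [← Finset.prod_image (f := fun q => (X q : MvPolynomial τ K)) hι.injOn]
    refine Finset.prod_dvd_prod_of_subset _ _ _ fun q hq => ?_
    obtain ⟨p, hp, rfl⟩ := Finset.mem_image.mp hq
    simpa using hp

end Radical

section Embeddings

variable {K : Type} [Field K] {v : ℕ} {n n' : Fin v → ℕ}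

theorem isUnit_det_iff_of_upper {k : ℕ} {g : Matrix (Fin k) (Fin k) K}
    (hu : ∀ a b, b < a → g a b = 0) : IsUnit g.det ↔ ∀ a, g a a ≠ 0 := by
  rw [Matrix.det_of_isUpperTriangular (M := g) fun a b h => hu a b h, isUnit_iff_ne_zero,
    Finset.prod_ne_zero_iff]
  simp

/-- The embedding of variables given by order embeddings of all rows. -/
def rowEmb (ε : ∀ i, Fin (n i + 1) ↪o Fin (n' i + 1)) (p : MVar v n) : MVar v n' :=
  ⟨p.1, ε p.1 p.2⟩

variable (ε : ∀ i, Fin (n i + 1) ↪o Fin (n' i + 1))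

theorem rowEmb_injective : Function.Injective (rowEmb ε) := by
  rintro ⟨i, j⟩ ⟨i', j'⟩ h
  obtain ⟨rfl, h⟩ := Sigma.mk.inj_iff.mp h
  rw [heq_iff_eq, EmbeddingLike.apply_eq_iff_eq] at h
  subst h
  rfl

theorem rowEmb_fst (p : MVar v n) : (rowEmb ε p).1 = p.1 := rfl

theorem mem_range_rowEmb {i : Fin v} {j : Fin (n' i + 1)} :
    (⟨i, j⟩ : MVar v n') ∈ Set.range (rowEmb ε) ↔ j ∈ Set.range (ε i) := by
  constructor
  · rintro ⟨⟨i', j'⟩, h⟩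
    obtain ⟨rfl, h⟩ := Sigma.mk.inj_iff.mp h
    exact ⟨j', eq_of_heq h⟩
  · rintro ⟨k, rfl⟩
    exact ⟨⟨i, k⟩, rfl⟩

variable {g : ∀ i, Matrix (Fin (n i + 1)) (Fin (n i + 1)) K}
  {g' : ∀ i, Matrix (Fin (n' i + 1)) (Fin (n' i + 1)) K}

theorem gAct_rename (hg : ∀ i k j, g' i (ε i k) (ε i j) = g i k j)
    (h0 : ∀ i j, ∀ k ∉ Set.range (ε i), g' i k (ε i j) = 0) (f : MvPolynomial (MVar v n) K) :
    gAct g' (rename (rowEmb ε) f) = rename (rowEmb ε) (gAct g f) := by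
  suffices h : (gAct g').comp (rename (rowEmb ε)) = (rename (rowEmb ε)).comp (gAct g) from
    congrArg (fun φ => φ f) h
  refine algHom_ext fun ⟨i, j⟩ => ?_
  rw [AlgHom.comp_apply, AlgHom.comp_apply, rename_X, gAct_X, gAct_X, map_sum]
  change ∑ k : Fin (n' i + 1), C (g' i k (ε i j)) * X (⟨i, k⟩ : MVar v n') = _
  symm
  refine Finset.sum_of_injOn (ε i) (ε i).injective.injOn
      (fun _ _ => Finset.mem_coe.mpr (Finset.mem_univ _)) (fun k _ hk => ?_)
    fun k _ => ?_
  · rw [h0 i j k (by simpa using hk), C_0, zero_mul]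
  · rw [map_mul, rename_C, rename_X, ← hg]
    rfl

theorem killCompl_gAct (hg : ∀ i k j, g' i (ε i k) (ε i j) = g i k j)
    (h0 : ∀ i k, ∀ j ∉ Set.range (ε i), g' i (ε i k) j = 0) (f : MvPolynomial (MVar v n') K) :
    killCompl (rowEmb_injective ε) (gAct g' f) =
      gAct g (killCompl (rowEmb_injective ε) f) := by
  suffices h : (killCompl (rowEmb_injective ε)).comp (gAct g') =
      (gAct g).comp (killCompl (rowEmb_injective ε)) from congrArg (fun φ => φ f) h
  have hX : ∀ p, killCompl (rowEmb_injective ε) (X (rowEmb ε p) : MvPolynomial _ K) = X p :=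
    fun p => by rw [← rename_X, killCompl_rename_app]
  have hX0 : ∀ q ∉ Set.range (rowEmb ε),
      killCompl (rowEmb_injective ε) (X q : MvPolynomial _ K) = 0 := fun q hq => by
    rw [killCompl, aeval_X, dif_neg hq]
  refine algHom_ext fun q => ?_
  rw [AlgHom.comp_apply, AlgHom.comp_apply, gAct_X, map_sum]
  have hsum : ∑ k, killCompl (rowEmb_injective ε)
      (C (g' q.1 k q.2) * X (⟨q.1, k⟩ : MVar v n')) =
      ∑ k, C (g' q.1 (ε q.1 k) q.2) * X (⟨q.1, k⟩ : MVar v n) := by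
    symm
    refine Finset.sum_of_injOn (ε q.1) (ε q.1).injective.injOn
      (fun _ _ => Finset.mem_coe.mpr (Finset.mem_univ _)) (fun k _ hk => ?_)
      fun k _ => ?_
    · rw [map_mul, hX0 _ fun h => hk (by simpa using (mem_range_rowEmb ε).mp h), mul_zero]
    · rw [map_mul, algHom_C, algebraMap_eq, ← hX]
      rfl
  rw [hsum]
  by_cases hq : q ∈ Set.range (rowEmb ε)
  · obtain ⟨p, rfl⟩ := hq
    rw [hX, gAct_X]
    exact Finset.sum_congr rfl fun k _ =>
      congrArg (fun c => C c * X (⟨p.1, k⟩ : MVar v n)) (hg p.1 k p.2)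
  · rw [hX0 q hq, map_zero]
    refine Finset.sum_eq_zero fun k _ => ?_
    rw [h0 _ _ _ fun h => hq ((mem_range_rowEmb ε).mpr h), C_0, zero_mul]

theorem BorelFixed.map_rename {J : Ideal (MvPolynomial (MVar v n) K)} (hJ : BorelFixed J)
    (hε : ∀ i, IsLowerSet (Set.range (ε i))) :
    BorelFixed (Ideal.map (rename (rowEmb ε)) J) := by
  refine borelFixed_of_gAct_mem fun g' hg' hu f hf => ?_
  suffices h : Ideal.map (rename (rowEmb ε)) J ≤
      Ideal.comap (gAct g') (Ideal.map (rename (rowEmb ε)) J) from h hf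
  have hu' : ∀ i (k j : Fin (n i + 1)), j < k → g' i (ε i k) (ε i j) = 0 :=
    fun i k j h => hu _ _ _ ((ε i).lt_iff_lt.mpr h)
  refine Ideal.map_le_iff_le_comap.mpr fun f hf => ?_
  rw [Ideal.mem_comap, Ideal.mem_comap,
    gAct_rename ε (g := fun i => (g' i).submatrix (ε i) (ε i)) (fun _ _ _ => rfl)
      fun i j k hk => hu _ _ _ (not_le.mp fun h => hk (hε i h ⟨j, rfl⟩))]
  refine Ideal.mem_map_of_mem _ (hJ.gAct_mem (fun i => ?_) hu' hf)
  exact (isUnit_det_iff_of_upper (hu' i)).mpr fun a =>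
    (isUnit_det_iff_of_upper (hu i)).mp (hg' i) _

theorem BorelFixed.comap_killCompl {J : Ideal (MvPolynomial (MVar v n) K)} (hJ : BorelFixed J)
    (hε : ∀ i, IsUpperSet (Set.range (ε i))) :
    BorelFixed (Ideal.comap (killCompl (rowEmb_injective ε)) J) := by
  refine borelFixed_of_gAct_mem fun g' hg' hu f hf => ?_
  have hu' : ∀ i (k j : Fin (n i + 1)), j < k → g' i (ε i k) (ε i j) = 0 :=
    fun i k j h => hu _ _ _ ((ε i).lt_iff_lt.mpr h)
  rw [Ideal.mem_comap, killCompl_gAct ε (g := fun i => (g' i).submatrix (ε i) (ε i))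
      (fun _ _ _ => rfl) fun i k j hj => hu _ _ _ (not_le.mp fun h => hj (hε i h ⟨k, rfl⟩))]
  refine hJ.gAct_mem (fun i => ?_) hu' hf
  exact (isUnit_det_iff_of_upper (hu' i)).mpr fun a =>
    (isUnit_det_iff_of_upper (hu i)).mp (hg' i) _

theorem BorelFixed.comap_rename {J : Ideal (MvPolynomial (MVar v n') K)} (hJ : BorelFixed J) :
    BorelFixed (Ideal.comap (rename (rowEmb ε)) J) := by
  classical
  refine borelFixed_of_gAct_mem fun g hg hu f hf => ?_
  let g' : ∀ i, Matrix (Fin (n' i + 1)) (Fin (n' i + 1)) K := fun i a b =>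
    if h : a ∈ Set.range (ε i) ∧ b ∈ Set.range (ε i) then g i h.1.choose h.2.choose
    else if a = b then 1 else 0
  have h1 : ∀ i k j, g' i (ε i k) (ε i j) = g i k j := by
    intro i k j
    have h : ε i k ∈ Set.range (ε i) ∧ ε i j ∈ Set.range (ε i) := ⟨⟨k, rfl⟩, ⟨j, rfl⟩⟩
    simp only [g']
    rw [dif_pos h, (ε i).injective h.1.choose_spec, (ε i).injective h.2.choose_spec]
  have h2 : ∀ i a b, ¬ (a ∈ Set.range (ε i) ∧ b ∈ Set.range (ε i)) →
      g' i a b = if a = b then 1 else 0 := fun i a b h => dif_neg h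
  have hu' : ∀ i (a b : Fin (n' i + 1)), b < a → g' i a b = 0 := by
    intro i a b hab
    by_cases h : a ∈ Set.range (ε i) ∧ b ∈ Set.range (ε i)
    · obtain ⟨⟨k, rfl⟩, j, rfl⟩ := h
      rw [h1]
      exact hu i k j ((ε i).lt_iff_lt.mp hab)
    · rw [h2 i a b h, if_neg hab.ne']
  rw [Ideal.mem_comap, ← gAct_rename ε h1 fun i j k hk => ?_]
  · refine hJ.gAct_mem (fun i => (isUnit_det_iff_of_upper (hu' i)).mpr fun a => ?_) hu' hf
    by_cases h : a ∈ Set.range (ε i)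
    · obtain ⟨k, rfl⟩ := h
      rw [h1]
      exact (isUnit_det_iff_of_upper (hu i)).mp (hg i) k
    · rw [h2 i a a fun h' => h h'.1, if_pos rfl]
      exact one_ne_zero
  · rw [h2 _ _ _ fun h => hk h.1, if_neg]
    rintro rfl
    exact hk ⟨j, rfl⟩

end Embeddings

section Counting

variable {v : ℕ} {n n' : Fin v → ℕ}

theorem rowCount_image [DecidableEq (MVar v n')] {ι : MVar v n → MVar v n'}
    (hι : Function.Injective ι) (hdeg : ∀ p, (ι p).1 = p.1) (i : Fin v) :
    rowCount (Finset.univ.image ι) i = n i + 1 := by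
  have h : ((Finset.univ.image ι).filter fun q => q.1 = i) =
      Finset.univ.image fun j : Fin (n i + 1) => ι ⟨i, j⟩ := by
    ext q
    simp only [Finset.mem_filter, Finset.mem_image, Finset.mem_univ, true_and]
    constructor
    · rintro ⟨⟨⟨i', j⟩, rfl⟩, hi⟩
      rw [hdeg] at hi
      obtain rfl : i' = i := hi
      exact ⟨j, rfl⟩
    · rintro ⟨j, rfl⟩
      exact ⟨⟨_, rfl⟩, hdeg _⟩
  rw [rowCount_apply, h, Finset.card_image_of_injective (f := fun j => ι ⟨i, j⟩) _
    (hι.comp sigma_mk_injective), Finset.card_univ, Fintype.card_fin]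

theorem le_of_injective {ι : MVar v n → MVar v n'} (hι : Function.Injective ι)
    (hdeg : ∀ p, (ι p).1 = p.1) (i : Fin v) : n i ≤ n' i := by
  classical
  have h := rowCount_mono (Finset.subset_univ (Finset.univ.image ι)) i
  have h' := rowCount_image (Function.injective_id (α := MVar v n')) (fun _ => rfl) i
  rw [Finset.image_id] at h'
  rw [rowCount_image hι hdeg, h'] at h
  omega

theorem eq_single_of_mdeg_eq {m : MVar v n →₀ ℕ} {i : Fin v}
    (hm : mdeg v n m = Finsupp.single i 1) : ∃ j, m = Finsupp.single ⟨i, j⟩ 1 := by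
  have h0 : m ≠ 0 := by
    rintro rfl
    rw [map_zero] at hm
    exact one_ne_zero (Finsupp.single_eq_zero.mp hm.symm)
  obtain ⟨⟨i', j⟩, hq⟩ := Finsupp.ne_iff.mp h0
  have hle : Finsupp.single (⟨i', j⟩ : MVar v n) 1 ≤ m :=
    Finsupp.single_le_iff.mpr (Nat.one_le_iff_ne_zero.mpr hq)
  obtain ⟨u, rfl⟩ := exists_add_of_le hle
  rw [map_add, mdeg_single] at hm
  have hi : i' = i := by
    by_contra h
    have := DFunLike.congr_fun hm i'
    simp [Ne.symm h] at this
  obtain rfl := hi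
  refine ⟨j, add_eq_left.mpr (Finsupp.ext fun q => Nat.le_zero.mp ((le_mdeg u q).trans ?_))⟩
  rw [add_eq_left.mp hm]
  exact le_rfl

theorem coeff_hser_single_le (M : Set (MVar v n →₀ ℕ)) (i : Fin v) :
    MvPowerSeries.coeff (Finsupp.single i 1) (hser M) ≤ n i + 1 := by
  rw [coeff_hser]
  have hsub : {m | m ∈ M ∧ mdeg v n m = Finsupp.single i 1} ⊆
      Set.range fun j : Fin (n i + 1) => Finsupp.single (⟨i, j⟩ : MVar v n) 1 := by
    rintro m ⟨-, hm⟩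
    obtain ⟨j, rfl⟩ := eq_single_of_mdeg_eq hm
    exact ⟨j, rfl⟩
  rw [← Set.image_univ] at hsub
  have h := (Set.ncard_le_ncard hsub (Set.toFinite _)).trans (Set.ncard_image_le Set.finite_univ)
  rw [Set.ncard_univ, Nat.card_eq_fintype_card, Fintype.card_fin] at h
  exact_mod_cast h

end Counting

section Restriction

variable {σ τ K : Type} [Field K] {v : ℕ} {n n' : Fin v → ℕ}

theorem comap_killCompl_comap_rename {ι : σ → τ} (hι : Function.Injective ι)
    {J : Ideal (MvPolynomial τ K)} (hJ : ∀ q ∉ Set.range ι, X q ∈ J) :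
    Ideal.comap (killCompl hι) (Ideal.comap (rename ι) J) = J := by
  have hker : Ideal.comap (killCompl hι) (⊥ : Ideal (MvPolynomial σ K)) ≤ J := by
    rw [← map_rename_sup_span_eq_comap hι, Ideal.map_bot, bot_sup_eq, Ideal.span_le]
    rintro _ ⟨q, hq, rfl⟩
    exact hJ q hq
  ext f
  have hf : rename ι (killCompl hι f) - f ∈ J := hker (by
    rw [Ideal.mem_comap, map_sub, killCompl_rename_app, sub_self]
    exact Ideal.zero_mem _)
  rw [Ideal.mem_comap, Ideal.mem_comap]
  exact ⟨fun h => (Submodule.sub_mem_iff_right J h).mp hf,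
    fun h => (Submodule.sub_mem_iff_left J h).mp hf⟩

variable {J : Ideal (MvPolynomial (MVar v n') K)}

theorem map_rename_comap_rename [Infinite K] {ι : MVar v n → MVar v n'}
    (hι : Function.Injective ι) (hJ : J.IsRadical) (hB : BorelFixed J)
    (hF : ∀ G, IsFace J G → ∃ F, IsFace J F ∧ G ⊆ F ∧ ∀ q ∉ Set.range ι, q ∈ F) :
    Ideal.map (rename ι) (Ideal.comap (rename ι) J) = J := by
  refine le_antisymm Ideal.map_comap_le fun f hf => ?_
  rw [f.as_sum]
  refine Ideal.sum_mem _ fun m hm => ?_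
  rw [← mul_one (coeff m f), ← C_mul_monomial]
  refine Ideal.mul_mem_left _ _ ?_
  rw [monomial_mem_map_rename_iff hι, Ideal.mem_comap, rename_monomial]
  by_contra h
  rw [← isFace_support_iff hJ] at h
  obtain ⟨F, hFJ, hGF, hF⟩ := hF _ h
  refine (isFace_support_iff hJ m).mp (hFJ.mono fun q hq => ?_) (hB.monomial_mem hf hm)
  by_cases hq' : q ∈ Set.range ι
  · obtain ⟨p, rfl⟩ := hq'
    refine hGF (Finsupp.mem_support_iff.mpr ?_)
    rw [Finsupp.mapDomain_apply hι, Finsupp.comapDomain_apply]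
    exact Finsupp.mem_support_iff.mp hq
  · exact hF q hq'

theorem X_mem_of_coeff_hser_le (hJ : J.IsRadical) (hB : BorelFixed J) {i : Fin v} {c : ℕ}
    (hc : MvPowerSeries.coeff (Finsupp.single i 1) (hser {m | monomial m (1 : K) ∉ J}) ≤ c)
    {k : Fin (n' i + 1)} (hk : c + k < n' i + 1) : X ⟨i, k⟩ ∈ J := by
  classical
  by_contra hX
  have hface : IsFace J {⟨i, k⟩} := by rwa [IsFace, Finset.prod_singleton]
  have hj : ∀ j ∈ Finset.Ici k, X (⟨i, j⟩ : MVar v n') ∉ J := by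
    intro j hj
    rcases (Finset.mem_Ici.mp hj).eq_or_lt with rfl | hlt
    · exact hX
    · have := (hface.insert hJ hB hlt (Finset.mem_singleton_self _)).mono
        (Finset.singleton_subset_iff.mpr (Finset.mem_insert_self _ _))
      rwa [IsFace, Finset.prod_singleton] at this
  rw [coeff_hser] at hc
  have hsub : (fun j => Finsupp.single (⟨i, j⟩ : MVar v n') 1) '' (Finset.Ici k : Set _) ⊆
      {m | m ∈ {m | monomial m (1 : K) ∉ J} ∧ mdeg v n' m = Finsupp.single i 1} := by
    rintro _ ⟨j, hjk, rfl⟩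
    exact ⟨hj j hjk, mdeg_single _ _⟩
  have h := (Set.ncard_le_ncard hsub (finite_fiber _ _)).trans (Int.ofNat_le.mp hc)
  have hinj : Function.Injective fun j => Finsupp.single (⟨i, j⟩ : MVar v n') 1 :=
    (Finsupp.single_left_injective one_ne_zero).comp sigma_mk_injective
  rw [Set.ncard_image_of_injective _ hinj, Set.ncard_coe_finset, Fin.card_Ici] at h
  omega

end Restriction

section CartwrightSturmfels

variable {K : Type} [Field K] {v : ℕ} {n n' : Fin v → ℕ}

/-- The embedding of the variables as the first variables of each row. -/
def firstEmb (hn : ∀ i, n i ≤ n' i) (i : Fin v) : Fin (n i + 1) ↪o Fin (n' i + 1) :=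
  Fin.castLEOrderEmb (Nat.succ_le_succ (hn i))

theorem mem_range_firstEmb (hn : ∀ i, n i ≤ n' i) {i : Fin v} {k : Fin (n' i + 1)} :
    k ∈ Set.range (firstEmb hn i) ↔ (k : ℕ) < n i + 1 :=
  ⟨fun ⟨j, hj⟩ => hj ▸ j.2, fun h => ⟨⟨k, h⟩, rfl⟩⟩

/-- The embedding of the variables as the last variables of each row. -/
def lastEmb (hn : ∀ i, n i ≤ n' i) (i : Fin v) : Fin (n i + 1) ↪o Fin (n' i + 1) :=
  OrderEmbedding.ofStrictMono (fun j => ⟨n' i - n i + j, by have := hn i; omega⟩)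
    fun _ _ h => Nat.add_lt_add_left h _

theorem mem_range_lastEmb (hn : ∀ i, n i ≤ n' i) {i : Fin v} {k : Fin (n' i + 1)} :
    k ∈ Set.range (lastEmb hn i) ↔ n' i - n i ≤ k := by
  refine ⟨fun ⟨j, hj⟩ => hj ▸ Nat.le_add_right _ _, fun h => ?_⟩
  have := hn i
  exact ⟨⟨k - (n' i - n i), by omega⟩, Fin.ext (Nat.add_sub_cancel' h)⟩

theorem isLowerSet_range_firstEmb (hn : ∀ i, n i ≤ n' i) (i : Fin v) :
    IsLowerSet (Set.range (firstEmb hn i)) := fun _ _ hab ha =>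
  (mem_range_firstEmb hn).mpr (lt_of_le_of_lt hab ((mem_range_firstEmb hn).mp ha))

theorem isUpperSet_range_lastEmb (hn : ∀ i, n i ≤ n' i) (i : Fin v) :
    IsUpperSet (Set.range (lastEmb hn i)) := fun _ _ hab ha =>
  (mem_range_lastEmb hn).mpr (((mem_range_lastEmb hn).mp ha).trans hab)

variable [Infinite K] {ι : MVar v n → MVar v n'} {I : Ideal (MvPolynomial (MVar v n) K)}

theorem isCS_map_rename_iff (hι : Function.Injective ι) (hdeg : ∀ p, (ι p).1 = p.1)
    (hI : IsMultigraded I) : IsCS (Ideal.map (rename ι) I) ↔ IsCS I := by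
  have hn := le_of_injective hι hdeg
  have hinj := rowEmb_injective (firstEmb hn)
  have hfst := rowEmb_fst (firstEmb hn)
  refine ⟨fun ⟨hI', J', hJ', hB, h⟩ => ?_, fun ⟨_, J, hJ, hB, h⟩ => ?_⟩
  · have hmap : Ideal.map (rename (rowEmb (firstEmb hn)))
        (Ideal.comap (rename (rowEmb (firstEmb hn))) J') = J' := by
      refine map_rename_comap_rename hinj hJ' hB fun G hG => ?_
      classical
      obtain ⟨Γ, _, _, _, θ, hθ⟩ := exists_injective_orderedAddMonoid v n'
      obtain ⟨p, hp, hTp⟩ := exists_hasDec (Finset.univ.image ι)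
        ⟨stdExps θ (Ideal.map (rename ι) I), isLowerSet_stdExps θ _⟩ fun q hq m hm => by
          have hq' : q ∉ Set.range ι := by simpa using hq
          change _ ∈ stdExps θ _ at hm ⊢
          rw [stdExps_map_rename hι] at hm ⊢
          rwa [Set.mem_ofPred_eq, Finsupp.comapDomain_add_of_injective hι,
            Finsupp.comapDomain_single_of_not_mem_range hq', zero_add]
      rw [LowerSet.coe_mk, (sameHS_iff_hser hθ hθ hI' hB.isMultigraded).mp h,
        hB.stdExps_eq θ] at hTp
      obtain ⟨F, hF, hGF, hAF⟩ := hG.exists_superset hJ' hB hp hTp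
      refine ⟨F, hF, hGF, fun ⟨i, j⟩ hq => hAF i j ?_⟩
      rw [rowCount_image hι hdeg]
      exact not_lt.mp fun h => hq ((mem_range_rowEmb _).mpr ((mem_range_firstEmb hn).mpr h))
    refine ⟨hI, Ideal.comap (rename (rowEmb (firstEmb hn))) J', hJ'.comap _,
      hB.comap_rename _, ?_⟩
    rw [← sameHS_map_rename_iff hι hdeg hinj hfst hI (hB.comap_rename _).isMultigraded, hmap]
    exact h
  · exact ⟨hI.map_rename hdeg, Ideal.map (rename (rowEmb (firstEmb hn))) J,
      isRadical_map_rename hinj hJ fun _ hf _ hm => hB.monomial_mem hf hm,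
      hB.map_rename _ (isLowerSet_range_firstEmb hn),
      (sameHS_map_rename_iff hι hdeg hinj hfst hI hB.isMultigraded).mpr h⟩

theorem isCS_comap_killCompl_iff (hι : Function.Injective ι) (hdeg : ∀ p, (ι p).1 = p.1)
    (hI : IsMultigraded I) : IsCS (Ideal.comap (killCompl hι) I) ↔ IsCS I := by
  have hn := le_of_injective hι hdeg
  have hinj := rowEmb_injective (lastEmb hn)
  have hfst := rowEmb_fst (lastEmb hn)
  refine ⟨fun ⟨hI', J', hJ', hB, h⟩ => ?_, fun ⟨_, J, hJ, hB, h⟩ => ?_⟩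
  · have hcomap : Ideal.comap (killCompl hinj)
        (Ideal.comap (rename (rowEmb (lastEmb hn))) J') = J' := by
      refine comap_killCompl_comap_rename hinj fun ⟨i, k⟩ hq => ?_
      rw [mem_range_rowEmb, mem_range_lastEmb, not_le] at hq
      obtain ⟨Γ, _, _, _, θ, hθ⟩ := exists_injective_orderedAddMonoid v n'
      refine X_mem_of_coeff_hser_le (c := n i + 1) hJ' hB ?_ (by omega)
      rw [← hB.stdExps_eq θ, ← (sameHS_iff_hser hθ hθ hI' hB.isMultigraded).mp h,
        stdExps_comap_killCompl hι, hser_image _ _ (Finsupp.mapDomain_injective hι)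
          (mdeg_mapDomain hdeg)]
      exact_mod_cast coeff_hser_single_le _ i
    refine ⟨hI, Ideal.comap (rename (rowEmb (lastEmb hn))) J', hJ'.comap _,
      hB.comap_rename _, ?_⟩
    rw [← sameHS_comap_killCompl_iff hι hdeg hinj hfst hI (hB.comap_rename _).isMultigraded,
      hcomap]
    exact h
  · exact ⟨hI.comap_killCompl hι hdeg, Ideal.comap (killCompl hinj) J, hJ.comap _,
      hB.comap_killCompl _ (isUpperSet_range_lastEmb hn),
      (sameHS_comap_killCompl_iff hι hdeg hinj hfst hI hB.isMultigraded).mpr h⟩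

end CartwrightSturmfels

end CSPaper

/-- **Proposition (closure under polynomial extensions).** Let `S' = S[z_1,…,z_u]` be a
polynomial extension of `S` with a standard `ℤ^v`-graded structure extending that of `S`
(realized by a degree-preserving injection `ι` of the variables of `S` into those of `S'`),
and let `I` be a `ℤ^v`-graded ideal of `S`.  The following are equivalent: `I` is CS;
`IS'` is CS; `IS' + (z_1,…,z_u)` is CS. -/
theorem CS_polynomial_extension
    {K : Type} [Field K] [Infinite K] {v : ℕ} {n n' : Fin v → ℕ}
    (ι : MVar v n → MVar v n') (hι : Function.Injective ι)
    (hdeg : ∀ p : MVar v n, (ι p).1 = p.1)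
    (I : Ideal (MvPolynomial (MVar v n) K)) (hI : IsMultigraded I) :
    (IsCS I ↔ IsCS (Ideal.map (rename ι) I)) ∧
    (IsCS I ↔ IsCS (Ideal.map (rename ι) I ⊔
      Ideal.span {f : MvPolynomial (MVar v n') K |
        ∃ q : MVar v n', q ∉ Set.range ι ∧ f = X q})) := by
  rw [map_rename_sup_span_eq_comap hι]
  exact ⟨(isCS_map_rename_iff hι hdeg hI).symm, (isCS_comap_killCompl_iff hι hdeg hI).symm⟩

end
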